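/- arXiv:2105.00299 — 9 statements merged into one kernel-verified Lean document; each statement's English description precedes it below -/
import Mathlib

section
/- For every deterministic online algorithm ALG (in the stated online model) that always outputs a dominating set, every real ε > 0, and every natural number M, there exist a finite tree T and a revelation order σ of its vertices in which every prefix induces a connected subgraph, such that γ(T) ≥ M and ALG(T,σ) ≥ (2 − ε)·γ(T). Consequently, no deterministic online algorithm has asymptotic competitive ratio smaller than 2 on trees. -/
open SimpleGraph

attribute [local instance] Classical.propDecidable

/-- `D` is a dominating set of `G`: every vertex is in `D` or adjacent to a member of `D`. -/
def IsDomSet {V : Type*} (G : SimpleGraph V) (D : Set V) : Prop :=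
  ∀ v : V, v ∈ D ∨ ∃ u ∈ D, G.Adj u v

/-- The domination number `γ(G)`: the minimum size of a dominating set. -/
noncomputable def domNum {V : Type*} [Fintype V] (G : SimpleGraph V) : ℕ :=
  sInf {k | ∃ D : Finset V, IsDomSet G ↑D ∧ D.card = k}

/-- Every prefix `{v_0, …, v_i}` of the revelation order induces a connected subgraph.
(The input graph is presented on `Fin n`, vertex `i` being revealed at time `i`.) -/
def PrefixConnected {n : ℕ} (G : SimpleGraph (Fin n)) : Prop :=
  ∀ i : Fin n, (SimpleGraph.induce {v : Fin n | v ≤ i} G).Connected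

/-- The information revealed by time `i`: the list of closed neighborhoods
`N[v_0], …, N[v_i]`, each as a set of natural-number vertex labels. -/
def history {n : ℕ} (G : SimpleGraph (Fin n)) (i : Fin n) : List (Set ℕ) :=
  (List.range ((i : ℕ) + 1)).map fun j =>
    {m : ℕ | ∃ v w : Fin n, (v : ℕ) = j ∧ (w : ℕ) = m ∧ (v = w ∨ G.Adj v w)}

/-- The set of vertices selected by the deterministic online algorithm `A`: the
(irrevocable) decision at time `i` is a function only of the information revealed
by time `i`. -/
noncomputable def algOutput {n : ℕ} (A : List (Set ℕ) → Bool) (G : SimpleGraph (Fin n)) :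
    Finset (Fin n) :=
  Finset.univ.filter fun i => A (history G i) = true

/-- The online algorithm `A` outputs a dominating set on every valid online input. -/
def AlwaysDominating (A : List (Set ℕ) → Bool) : Prop :=
  ∀ (n : ℕ) (G : SimpleGraph (Fin n)), G.Connected → PrefixConnected G →
    IsDomSet G ↑(algOutput A G)

/-- Types of pending vertices: plain leaf, paid leaf, hub, fresh. -/
inductive VTy
  | L | P | H | F

/-- credit of a pending vertex -/
def VTy.w : VTy → ℕ
  | .L => 0 | .P => 1 | .H => 1 | .F => 0

/-- indicator of fresh vertices -/
def VTy.f : VTy → ℕ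
  | .L => 0 | .P => 0 | .H => 0 | .F => 1

/-- measure for the closing phase -/
def VTy.mu : VTy → ℕ
  | .L => 1 | .P => 1 | .H => 3 | .F => 1

/-- Graph on `Fin n` given by a parent function. -/
def tg (par : ℕ → ℕ) (n : ℕ) : SimpleGraph (Fin n) where
  Adj v w := v ≠ w ∧ (par w = v ∨ par v = w)
  symm := ⟨fun v w h => ⟨h.1.symm, h.2.symm⟩⟩
  loopless := ⟨fun v h => h.1 rfl⟩

/-- history in terms of the parent function -/
def hs (par : ℕ → ℕ) (n i : ℕ) : List (Set ℕ) :=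
  (List.range (i + 1)).map fun j => {m : ℕ | j < n ∧ m < n ∧ (j = m ∨ par m = j ∨ par j = m)}

lemma history_tg (par : ℕ → ℕ) (n : ℕ) (i : Fin n) : history (tg par n) i = hs par n i := by
  unfold history hs
  apply List.map_congr_left
  intro j _
  ext m
  simp only [Set.mem_ofPred_eq, tg]
  constructor
  · rintro ⟨v, w, rfl, rfl, h⟩
    refine ⟨v.2, w.2, ?_⟩
    rcases h with h | h
    · left; rw [h]
    · right; exact h.2
  · rintro ⟨hj, hm, h⟩
    refine ⟨⟨j, hj⟩, ⟨m, hm⟩, rfl, rfl, ?_⟩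
    by_cases e : j = m
    · left; simp [e]
    · right
      refine ⟨by simpa using e, ?_⟩
      rcases h with h | h
      · exact absurd h e
      · exact h

/-- selected indicator -/
noncomputable def sl (A : List (Set ℕ) → Bool) (par : ℕ → ℕ) (n i : ℕ) : ℕ :=
  (A (hs par n i)).toNat

lemma card_algOutput (A : List (Set ℕ) → Bool) (par : ℕ → ℕ) (n : ℕ) :
    (algOutput A (tg par n)).card = ∑ m ∈ Finset.range n, sl A par n m := by
  rw [← Fin.sum_univ_eq_sum_range, algOutput, Finset.card_filter]
  apply Finset.sum_congr rfl
  intro i _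
  rw [history_tg, sl]
  cases A (hs par n i) <;> simp

/-- the extension of a parent function -/
def extp (par : ℕ → ℕ) (n i : ℕ) : ℕ → ℕ := fun m => if m < n then par m else i

lemma hs_ext (par : ℕ → ℕ) (hp : ∀ a, par a ≤ a) (n i k j : ℕ) (hj : j < i) (hi : i < n) :
    hs (extp par n i) (n + k) j = hs par n j := by
  unfold hs
  apply List.map_congr_left
  intro a ha
  have ha : a < j + 1 := by simpa using ha
  ext m
  simp only [Set.mem_ofPred_eq, extp]
  have : a < n := by omega
  simp only [this, if_true]
  by_cases hm : m < n
  · simp only [hm, if_true]; constructor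
    · rintro ⟨_, _, h⟩; exact ⟨trivial, trivial, h⟩
    · rintro ⟨_, _, h⟩; exact ⟨by omega, by omega, h⟩
  · simp only [hm, if_false]
    have := hp a
    constructor
    · rintro ⟨_, _, h⟩; omega
    · rintro ⟨_, h, _⟩; exact h.elim

lemma sl_ext (A : List (Set ℕ) → Bool) (par : ℕ → ℕ) (hp : ∀ a, par a ≤ a) (n i k j : ℕ) (hj : j < i) (hi : i < n) :
    sl A (extp par n i) (n + k) j = sl A par n j := by
  unfold sl; rw [hs_ext _ hp _ _ _ _ hj hi]

lemma par_le {par : ℕ → ℕ} (h0 : par 0 = 0) (hp : ∀ j, 0 < j → par j < j) (a : ℕ) : par a ≤ a := by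
  rcases Nat.eq_zero_or_pos a with rfl | h
  · exact h0.le
  · exact (hp a h).le

lemma tg_prefix {par : ℕ → ℕ} (hp : ∀ j, 0 < j → par j < j) (n : ℕ) :
    PrefixConnected (tg par n) := by
  intro i
  have hn : 0 < n := by have := i.2; omega
  have key : ∀ (v : ℕ) (hv : v < n) (hvi : (⟨v, hv⟩ : Fin n) ≤ i),
      (SimpleGraph.induce {v : Fin n | v ≤ i} (tg par n)).Reachable
        ⟨⟨0, hn⟩, show (⟨0, hn⟩ : Fin n) ≤ i from Nat.zero_le _⟩ ⟨⟨v, hv⟩, hvi⟩ := by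
    intro v
    induction v using Nat.strong_induction_on with
    | _ v ih =>
      intro hv hvi
      rcases Nat.eq_zero_or_pos v with rfl | h
      · exact Reachable.refl _
      · have hlt := hp v h
        have hvi' : v ≤ (i : ℕ) := by simpa [Fin.le_def] using hvi
        refine (ih (par v) hlt (by omega) (by simp only [Fin.le_def]; omega)).trans ?_
        apply Adj.reachable
        simp only [comap_adj, tg, Function.Embedding.subtype_apply]
        refine ⟨?_, by simp⟩
        intro e
        have := congrArg Fin.val e
        simp at this
        omega
  have : Nonempty ({v : Fin n | v ≤ i} : Set (Fin n)) := ⟨⟨i, le_refl i⟩⟩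
  refine ⟨fun u v => ?_⟩
  obtain ⟨⟨u, hu⟩, hui⟩ := u
  obtain ⟨⟨v, hv⟩, hvi⟩ := v
  exact (key u hu hui).symm.trans (key v hv hvi)

lemma tg_conn {par : ℕ → ℕ} (hp : ∀ j, 0 < j → par j < j) (n : ℕ) (hn : 0 < n) :
    (tg par n).Connected := by
  have key : ∀ (v : ℕ) (hv : v < n), (tg par n).Reachable ⟨0, hn⟩ ⟨v, hv⟩ := by
    intro v
    induction v using Nat.strong_induction_on with
    | _ v ih =>
      intro hv
      rcases Nat.eq_zero_or_pos v with rfl | h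
      · exact Reachable.refl _
      · have hlt := hp v h
        refine (ih (par v) hlt (by omega)).trans ?_
        apply Adj.reachable
        refine ⟨?_, by simp⟩
        intro e
        have := congrArg Fin.val e
        simp at this
        omega
  have : Nonempty (Fin n) := ⟨⟨0, hn⟩⟩
  exact ⟨fun u v => (key u u.2).symm.trans (key v v.2)⟩

lemma tg_tree {par : ℕ → ℕ} (h0 : par 0 = 0) (hp : ∀ j, 0 < j → par j < j) (n : ℕ) (hn : 0 < n) :
    (tg par n).IsTree := by
  have hc := tg_conn hp n hn
  rw [isTree_iff_connected_and_card]
  refine ⟨hc, le_antisymm ?_ hc.card_vert_le_card_edgeSet_add_one⟩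
  let g : Fin n → Sym2 (Fin n) := fun v => s(v, ⟨par v, (par_le h0 hp v).trans_lt v.2⟩)
  have hsub : (tg par n).edgeSet ⊆
      (((Finset.univ.erase (⟨0, hn⟩ : Fin n)).image g : Finset (Sym2 (Fin n))) : Set _) := by
    intro e
    induction e with
    | _ v w =>
      intro h
      have h : v ≠ w ∧ (par w = v ∨ par v = w) := h
      simp only [Finset.coe_image, Set.mem_image, Finset.mem_coe, Finset.mem_erase,
        Finset.mem_univ, and_true]
      rcases h with ⟨hne, h | h⟩
      · refine ⟨w, ?_, ?_⟩
        · rintro rfl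
          exact hne (Fin.ext (by rw [← h]; exact h0))
        · have : v = ⟨par w, (par_le h0 hp w).trans_lt w.2⟩ := Fin.ext h.symm
          rw [this]; exact Sym2.eq_swap
      · refine ⟨v, ?_, ?_⟩
        · rintro rfl
          exact hne (Fin.ext (by rw [← h]; exact h0.symm))
        · have : w = ⟨par v, (par_le h0 hp v).trans_lt v.2⟩ := Fin.ext h.symm
          rw [this]
  have h1 : Nat.card (tg par n).edgeSet ≤ (Finset.univ.erase (⟨0, hn⟩ : Fin n)).card := by
    rw [Nat.card_coe_set_eq]
    refine (Set.ncard_le_ncard hsub (Finset.finite_toSet _)).trans ?_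
    rw [Set.ncard_coe_finset]
    exact Finset.card_image_le
  rw [Finset.card_erase_of_mem (Finset.mem_univ _), Finset.card_univ, Fintype.card_fin] at h1
  rw [Nat.card_fin]
  omega

/-- `j` is dominated by `D`. -/
def dm (par : ℕ → ℕ) (n : ℕ) (D : Finset ℕ) (j : ℕ) : Prop :=
  ∃ d ∈ D, d < n ∧ (d = j ∨ par d = j ∨ par j = d)

lemma dm_ext {par : ℕ → ℕ} {n : ℕ} {D D' : Finset ℕ} {j : ℕ} (i k : ℕ) (hj : j < n)
    (hD : D ⊆ D') (h : dm par n D j) : dm (extp par n i) (n + k) D' j := by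
  obtain ⟨d, hd, hn, h⟩ := h
  refine ⟨d, hD hd, by omega, ?_⟩
  simpa [extp, hn, hj] using h

/-- The adversary's invariant. -/
structure AInv (A : List (Set ℕ) → Bool) (c i n : ℕ) (par : ℕ → ℕ) (ty : ℕ → VTy)
    (D : Finset ℕ) : Prop where
  h0 : par 0 = 0
  hp : ∀ j, 0 < j → par j < j
  hin : i ≤ n
  hn : 0 < n
  hpi : ∀ j, 0 < j → j < n → par j < i
  deg : ∀ j, ((Finset.range n).filter fun m => par m = j).card ≤ 4
  dom : ∀ j, j < n → (j < i ∨ ty j ≠ VTy.F) → dm par n D j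
  paid : ∀ j, i ≤ j → j < n → ty j = VTy.P → 0 < j ∧ sl A par n (par j) = 0
  hub : ∀ j, i ≤ j → j < n → ty j = VTy.H → j ∈ D
  bal : 2 * D.card ≤ ∑ m ∈ Finset.range i, sl A par n m + ∑ m ∈ Finset.Ico i n, (ty m).w + c

/-- new types -/
def ext_ty (ty : ℕ → VTy) (n : ℕ) (τ : ℕ → VTy) : ℕ → VTy := fun m => if m < n then ty m else τ m

lemma sum_step (ty : ℕ → VTy) (τ : ℕ → VTy) (g : VTy → ℕ) (i n k : ℕ) (hi : i < n) :
    ∑ m ∈ Finset.Ico (i + 1) (n + k), g (ext_ty ty n τ m) + g (ty i)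
      = ∑ m ∈ Finset.Ico i n, g (ty m) + ∑ m ∈ Finset.Ico n (n + k), g (τ m) := by
  rw [Finset.sum_eq_sum_Ico_succ_bot hi,
    ← Finset.sum_Ico_consecutive _ (show i + 1 ≤ n by omega) (show n ≤ n + k by omega)]
  have h1 : ∑ m ∈ Finset.Ico (i + 1) n, g (ext_ty ty n τ m) = ∑ m ∈ Finset.Ico (i + 1) n, g (ty m) := by
    apply Finset.sum_congr rfl
    intro m hm
    simp only [Finset.mem_Ico] at hm
    simp [ext_ty, hm.2]
  have h2 : ∑ m ∈ Finset.Ico n (n + k), g (ext_ty ty n τ m) = ∑ m ∈ Finset.Ico n (n + k), g (τ m) := by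
    apply Finset.sum_congr rfl
    intro m hm
    simp only [Finset.mem_Ico] at hm
    simp [ext_ty, not_lt.mpr hm.1]
  rw [h1, h2]; ring

lemma AInv.step {A : List (Set ℕ) → Bool} {c i n : ℕ} {par : ℕ → ℕ} {ty : ℕ → VTy}
    {D : Finset ℕ} (I : AInv A c i n par ty D) (hi : i < n) (k : ℕ) (hk : k ≤ 3)
    (τ : ℕ → VTy) (D' : Finset ℕ) (hD : D ⊆ D')
    (hdi : ty i = VTy.F → dm (extp par n i) (n + k) D' i)
    (hdn : ∀ m, n ≤ m → m < n + k → τ m ≠ VTy.F → dm (extp par n i) (n + k) D' m)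
    (hP : ∀ m, n ≤ m → m < n + k → τ m = VTy.P → sl A (extp par n i) (n + k) i = 0)
    (hH : ∀ m, n ≤ m → m < n + k → τ m = VTy.H → m ∈ D')
    (hb : 2 * D'.card + (ty i).w ≤ 2 * D.card + sl A (extp par n i) (n + k) i
      + ∑ m ∈ Finset.Ico n (n + k), (τ m).w) :
    AInv A c (i + 1) (n + k) (extp par n i) (ext_ty ty n τ) D' where
  h0 := by simp [extp, I.hn, I.h0]
  hp := by
    intro j hj
    have := I.hp j hj
    unfold extp; split <;> omega
  hin := by omega
  hn := by omega
  hpi := by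
    intro j hj _
    unfold extp; split
    · have := I.hpi j hj ‹_›; omega
    · omega
  deg := by
    intro j
    rw [Finset.range_eq_Ico, ← Finset.Ico_union_Ico_eq_Ico (Nat.zero_le n) (show n ≤ n + k by omega),
      Finset.filter_union]
    refine (Finset.card_union_le _ _).trans ?_
    have e1 : (Finset.filter (fun m => extp par n i m = j) (Finset.Ico 0 n))
        = (Finset.range n).filter fun m => par m = j := by
      rw [← Finset.range_eq_Ico]
      apply Finset.filter_congr
      intro m hm
      simp [extp, Finset.mem_range.mp hm]
    rw [e1]
    by_cases hj : j = i
    · subst hj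
      have a1 : ((Finset.range n).filter fun m => par m = j).card ≤ 1 := by
        refine (Finset.card_le_card (t := {0}) ?_).trans (by simp)
        intro m hm
        simp only [Finset.mem_filter, Finset.mem_range] at hm
        by_contra h
        have h : 0 < m := by simp at h; omega
        have := I.hpi m h hm.1
        omega
      have a2 := Finset.card_filter_le (Finset.Ico n (n + k)) (fun m => extp par n j m = j)
      simp at a2
      omega
    · have : (Finset.filter (fun m => extp par n i m = j) (Finset.Ico n (n + k))) = ∅ := by
        apply Finset.filter_eq_empty_iff.mpr
        intro m hm
        simp only [Finset.mem_Ico] at hm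
        simp only [extp, not_lt.mpr hm.1, if_false]
        exact fun h => hj h.symm
      rw [this]
      simpa using I.deg j
  dom := by
    intro j hj h
    by_cases hjn : j < n
    · by_cases hjd : j < i ∨ ty j ≠ VTy.F
      · exact dm_ext i k hjn hD (I.dom j hjn hjd)
      · push Not at hjd
        have : j = i := by
          rcases h with h | h
          · omega
          · simp [ext_ty, hjn, hjd.2] at h
        subst this
        exact hdi hjd.2
    · apply hdn j (by omega) hj
      rcases h with h | h
      · omega
      · simpa [ext_ty, hjn] using h
  paid := by
    intro j hj hjn h
    refine ⟨by omega, ?_⟩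
    by_cases hjn : j < n
    · have h : ty j = VTy.P := by simpa [ext_ty, hjn] using h
      have e : extp par n i j = par j := by simp [extp, hjn]
      have := I.paid j (by omega) hjn h
      rw [e, sl_ext A par (par_le I.h0 I.hp) n i k _ (I.hpi j this.1 hjn) hi]
      exact this.2
    · have e : extp par n i j = i := by simp [extp, hjn]
      rw [e]
      exact hP j (by omega) (by omega) (by simpa [ext_ty, hjn] using h)
  hub := by
    intro j hj hjn h
    by_cases hjn' : j < n
    · exact hD (I.hub j (by omega) hjn' (by simpa [ext_ty, hjn'] using h))
    · exact hH j (by omega) hjn (by simpa [ext_ty, hjn'] using h)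
  bal := by
    have h1 := sum_step ty τ VTy.w i n k hi
    have h2 : ∑ m ∈ Finset.range i, sl A (extp par n i) (n + k) m
        = ∑ m ∈ Finset.range i, sl A par n m := by
      apply Finset.sum_congr rfl
      intro m hm
      exact sl_ext A par (par_le I.h0 I.hp) n i k m (Finset.mem_range.mp hm) hi
    rw [Finset.sum_range_succ, h2]
    have := I.bal
    omega

lemma dom_of_alg {A : List (Set ℕ) → Bool} (hA : AlwaysDominating A) {par : ℕ → ℕ}
    (h0 : par 0 = 0) (hp : ∀ j, 0 < j → par j < j) {n : ℕ} (i : ℕ) (hi : i < n)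
    (hleaf : ∀ m, 0 < m → m < n → par m ≠ i) (hi0 : 0 < i)
    (hs0 : sl A par n (par i) = 0) : sl A par n i = 1 := by
  have hd := hA n (tg par n) (tg_conn hp n (by omega)) (tg_prefix hp n) ⟨i, hi⟩
  simp only [algOutput, history_tg, Finset.coe_filter, Finset.mem_univ, true_and,
    Set.mem_ofPred_eq] at hd
  rcases hd with h | ⟨u, hu, hne, h⟩
  · simp [sl, h]
  · exfalso
    rcases h with h | h
    · have h : par i = u := h
      rw [h] at hs0
      simp [sl, hu] at hs0
    · have h : par u = i := h
      have : (u : ℕ) = 0 ∨ 0 < (u : ℕ) := by omega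
      rcases this with h' | h'
      · have hpu : (u : ℕ) < i := by omega
        rw [h', h0] at h
        omega
      · exact hleaf u h' u.2 h

lemma sl_cases (A : List (Set ℕ) → Bool) (par : ℕ → ℕ) (n i : ℕ) :
    sl A par n i = 0 ∨ sl A par n i = 1 := by
  unfold sl; cases A (hs par n i) <;> simp

lemma AInv.step_L {A : List (Set ℕ) → Bool} {c i n : ℕ} {par : ℕ → ℕ} {ty : ℕ → VTy}
    {D : Finset ℕ} (I : AInv A c i n par ty D) (hi : i < n) (h : ty i = VTy.L) :
    AInv A c (i + 1) (n + 0) (extp par n i) (ext_ty ty n ty) D := by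
  apply I.step hi 0 (by omega) ty D (Finset.Subset.refl _)
  · simp [h]
  · intro m _ _; omega
  · intro m _ _; omega
  · intro m _ _; omega
  · simp [h, VTy.w]

lemma AInv.step_P {A : List (Set ℕ) → Bool} (hA : AlwaysDominating A) {c i n : ℕ} {par : ℕ → ℕ}
    {ty : ℕ → VTy}
    {D : Finset ℕ} (I : AInv A c i n par ty D) (hi : i < n) (h : ty i = VTy.P) :
    AInv A c (i + 1) (n + 0) (extp par n i) (ext_ty ty n ty) D := by
  apply I.step hi 0 (by omega) ty D (Finset.Subset.refl _)
  · simp [h]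
  · intro m _ _; omega
  · intro m _ _; omega
  · intro m _ _; omega
  · obtain ⟨hi0, hs⟩ := I.paid i le_rfl hi h
    have e : extp par n i i = par i := by simp [extp, hi]
    have : sl A (extp par n i) (n + 0) i = 1 := by
      refine dom_of_alg hA ?_ ?_ _ (by omega) ?_ hi0 ?_
      · simp [extp, I.h0, I.hn]
      · intro j hj
        have := I.hp j hj
        unfold extp; split <;> omega
      · intro m hm hmn
        have := I.hpi m hm hmn
        have hmn : m < n := hmn
        simp only [extp, hmn, if_true]
        omega
      · rw [e, sl_ext A par (par_le I.h0 I.hp) n i 0 _ (I.hp i hi0) hi]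
        exact hs
    rw [this]
    simp [h, VTy.w]

lemma AInv.step_H {A : List (Set ℕ) → Bool} {c i n : ℕ} {par : ℕ → ℕ}
    {ty : ℕ → VTy} {D : Finset ℕ} (I : AInv A c i n par ty D) (hi : i < n) (h : ty i = VTy.H) :
    ∃ τ : VTy, (τ = VTy.L ∨ τ = VTy.P) ∧
    AInv A c (i + 1) (n + 2) (extp par n i) (ext_ty ty n fun _ => τ) D := by
  have hiD : i ∈ D := I.hub i le_rfl hi h
  have hdn : ∀ m, n ≤ m → dm (extp par n i) (n + 2) D m := by
    intro m hm
    exact ⟨i, hiD, by omega, Or.inr (Or.inr (by simp [extp, not_lt.mpr hm]))⟩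
  rcases sl_cases A (extp par n i) (n + 2) i with hs | hs
  · refine ⟨VTy.P, Or.inr rfl, ?_⟩
    apply I.step hi 2 (by omega) _ D (Finset.Subset.refl _)
    · simp [h]
    · intro m hm _ _; exact hdn m hm
    · intro m _ _ _; exact hs
    · intro m _ _ hh; cases hh
    · rw [hs]; simp [h, VTy.w]
  · refine ⟨VTy.L, Or.inl rfl, ?_⟩
    apply I.step hi 2 (by omega) _ D (Finset.Subset.refl _)
    · simp [h]
    · intro m hm _ _; exact hdn m hm
    · intro m _ _ hh; cases hh
    · intro m _ _ hh; cases hh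
    · rw [hs]; simp [h, VTy.w]

lemma AInv.step_F {A : List (Set ℕ) → Bool} {c i n : ℕ} {par : ℕ → ℕ}
    {ty : ℕ → VTy} {D : Finset ℕ} (I : AInv A c i n par ty D) (hi : i < n) (h : ty i = VTy.F)
    (k : ℕ) (hk2 : 2 ≤ k) (hk3 : k ≤ 3) :
    ∃ τ D', AInv A c (i + 1) (n + k) (extp par n i) (ext_ty ty n τ) D' ∧
      (∑ m ∈ Finset.Ico n (n + k), (τ m).f = k - 1 ∨
       ∑ m ∈ Finset.Ico n (n + k), (τ m).f = k - 2) := by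
  have hk : k = 2 ∨ k = 3 := by omega
  rcases sl_cases A (extp par n i) (n + k) i with hs | hs
  · refine ⟨fun m => if m < n + 2 then VTy.P else VTy.F, insert i D, ?_, Or.inr ?_⟩
    · apply I.step hi k hk3 _ _ (Finset.subset_insert _ _)
      · intro _
        exact ⟨i, Finset.mem_insert_self _ _, by omega, Or.inl rfl⟩
      · intro m hm _ _
        exact ⟨i, Finset.mem_insert_self _ _, by omega,
          Or.inr (Or.inr (by simp [extp, not_lt.mpr hm]))⟩
      · intro m _ _ _; exact hs
      · intro m _ _ hh
        split at hh <;> cases hh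
      · have := Finset.card_insert_le i D
        rw [hs, h]
        have : 2 ≤ ∑ m ∈ Finset.Ico n (n + k), (if m < n + 2 then VTy.P else VTy.F).w := by
          rcases hk with rfl | rfl
          · simp [Finset.sum_Ico_eq_sum_range, Finset.sum_range_succ, VTy.w]
          · simp [Finset.sum_Ico_eq_sum_range, Finset.sum_range_succ, VTy.w]
        simp only [VTy.w] at this ⊢
        omega
    · rcases hk with rfl | rfl
      · simp [Finset.sum_Ico_eq_sum_range, Finset.sum_range_succ, VTy.f]
      · simp [Finset.sum_Ico_eq_sum_range, Finset.sum_range_succ, VTy.f]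
  · refine ⟨fun m => if m < n + 1 then VTy.H else VTy.F, insert n D, ?_, Or.inl ?_⟩
    · apply I.step hi k hk3 _ _ (Finset.subset_insert _ _)
      · intro _
        exact ⟨n, Finset.mem_insert_self _ _, by omega, Or.inr (Or.inl (by simp [extp]))⟩
      · intro m hm _ hh
        have : m = n := by
          by_contra hne
          exact hh (if_neg (by omega))
        exact ⟨n, Finset.mem_insert_self _ _, by omega, Or.inl this.symm⟩
      · intro m _ _ hh
        split at hh <;> cases hh
      · intro m hm _ hh
        split at hh
        · have : m = n := by omega
          rw [this]; exact Finset.mem_insert_self _ _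
        · cases hh
      · have := Finset.card_insert_le n D
        rw [hs, h]
        have : 1 ≤ ∑ m ∈ Finset.Ico n (n + k), (if m < n + 1 then VTy.H else VTy.F).w := by
          rcases hk with rfl | rfl
          · simp [Finset.sum_Ico_eq_sum_range, Finset.sum_range_succ, VTy.w]
          · simp [Finset.sum_Ico_eq_sum_range, Finset.sum_range_succ, VTy.w]
        simp only [VTy.w] at this ⊢
        omega
    · rcases hk with rfl | rfl
      · simp [Finset.sum_Ico_eq_sum_range, Finset.sum_range_succ, VTy.f]
      · simp [Finset.sum_Ico_eq_sum_range, Finset.sum_range_succ, VTy.f]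

lemma main_phase {A : List (Set ℕ) → Bool} (hA : AlwaysDominating A) (T : ℕ) :
    ∃ n par ty D, AInv A 0 T n par ty D ∧ 1 ≤ ∑ m ∈ Finset.Ico T n, (ty m).f ∧
      ∑ m ∈ Finset.Ico T n, (ty m).f ≤ 2 := by
  induction T with
  | zero =>
    refine ⟨1, fun _ => 0, fun _ => VTy.F, ∅, ?_, by simp [VTy.f], by simp [VTy.f]⟩
    constructor
    · rfl
    · exact fun j hj => hj
    · omega
    · omega
    · intro j _ _; omega
    · intro j
      exact (Finset.card_filter_le _ _).trans (by simp)
    · intro j _ h; simp at h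
    · intro j _ _ h; cases h
    · intro j _ _ h; cases h
    · simp
  | succ T ih =>
    obtain ⟨n, par, ty, D, I, hl, hu⟩ := ih
    have hT : T < n := by
      by_contra h
      rw [Finset.Ico_eq_empty (by omega)] at hl
      simp at hl
    cases h : ty T with
    | L =>
      have e := sum_step ty ty VTy.f T n 0 hT
      refine ⟨_, _, _, _, I.step_L hT h, ?_⟩
      simp [h, VTy.f] at e ⊢
      simp [VTy.f] at hl hu
      omega
    | P =>
      have e := sum_step ty ty VTy.f T n 0 hT
      refine ⟨_, _, _, _, I.step_P hA hT h, ?_⟩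
      simp [h, VTy.f] at e ⊢
      simp [VTy.f] at hl hu
      omega
    | H =>
      obtain ⟨τ, hτ, I'⟩ := I.step_H hT h
      have e := sum_step ty (fun _ => τ) VTy.f T n 2 hT
      refine ⟨_, _, _, _, I', ?_⟩
      have : τ.f = 0 := by rcases hτ with rfl | rfl <;> rfl
      have h2 : (ty T).f = 0 := by rw [h]; rfl
      simp only [this, h2, Finset.sum_const_zero] at e
      omega
    | F =>
      have h2 : (ty T).f = 1 := by rw [h]; rfl
      by_cases h1 : ∑ m ∈ Finset.Ico T n, (ty m).f = 1
      · obtain ⟨τ, D', I', hs⟩ := I.step_F hT h 3 (by omega) (by omega)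
        have e := sum_step ty τ VTy.f T n 3 hT
        refine ⟨_, _, _, _, I', ?_⟩
        omega
      · obtain ⟨τ, D', I', hs⟩ := I.step_F hT h 2 (by omega) (by omega)
        have e := sum_step ty τ VTy.f T n 2 hT
        refine ⟨_, _, _, _, I', ?_⟩
        omega

lemma closing {A : List (Set ℕ) → Bool} (hA : AlwaysDominating A) (c s : ℕ) :
    ∀ (i n : ℕ) (par : ℕ → ℕ) (ty : ℕ → VTy) (D : Finset ℕ), AInv A c i n par ty D →
      ∑ m ∈ Finset.Ico i n, (ty m).f = 0 → ∑ m ∈ Finset.Ico i n, (ty m).mu ≤ s →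
      ∃ n' par' ty', i ≤ n' ∧ AInv A c n' n' par' ty' D := by
  induction s with
  | zero =>
    intro i n par ty D I _ hs
    have : i = n := by
      by_contra h
      have := I.hin
      rw [Finset.sum_eq_sum_Ico_succ_bot (by omega)] at hs
      cases h : ty i <;> simp [h, VTy.mu] at hs
    subst this
    exact ⟨i, par, ty, le_rfl, I⟩
  | succ s ih =>
    intro i n par ty D I hf hs
    by_cases hi : i = n
    · subst hi
      exact ⟨i, par, ty, le_rfl, I⟩
    have hi : i < n := by have := I.hin; omega
    have fin : ∀ (k : ℕ) (τ : ℕ → VTy),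
        AInv A c (i + 1) (n + k) (extp par n i) (ext_ty ty n τ) D →
        ∑ m ∈ Finset.Ico n (n + k), (τ m).f = 0 →
        ∑ m ∈ Finset.Ico n (n + k), (τ m).mu + 1 ≤ (ty i).mu →
        ∃ n' par' ty', i ≤ n' ∧ AInv A c n' n' par' ty' D := by
      intro k τ I' h1 h2
      have e1 := sum_step ty τ VTy.f i n k hi
      have e2 := sum_step ty τ VTy.mu i n k hi
      obtain ⟨n', par', ty', hh, J⟩ := ih _ _ _ _ _ I' (by omega) (by omega)
      exact ⟨n', par', ty', by omega, J⟩
    cases h : ty i with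
    | L => exact fin 0 ty (I.step_L hi h) (by simp) (by simp [h, VTy.mu])
    | P => exact fin 0 ty (I.step_P hA hi h) (by simp) (by simp [h, VTy.mu])
    | H =>
      obtain ⟨τ, hτ, I'⟩ := I.step_H hi h
      refine fin 2 _ I' ?_ ?_
      · rcases hτ with rfl | rfl <;> simp [VTy.f]
      · rcases hτ with rfl | rfl <;> simp [h, VTy.mu]
    | F =>
      rw [Finset.sum_eq_sum_Ico_succ_bot hi] at hf
      simp [h, VTy.f] at hf

/-- turn fresh vertices into leaves -/
def VTy.close : VTy → VTy
  | .L => .L | .P => .P | .H => .H | .F => .L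

/-- fresh test -/
def VTy.isF : VTy → Bool
  | .F => true | _ => false

lemma AInv.close {A : List (Set ℕ) → Bool} {i n : ℕ} {par : ℕ → ℕ}
    {ty : ℕ → VTy} {D : Finset ℕ} (I : AInv A 0 i n par ty D)
    (hf : ∑ m ∈ Finset.Ico i n, (ty m).f ≤ 2) :
    AInv A 4 i n par (fun m => (ty m).close)
      (D ∪ (Finset.Ico i n).filter fun m => (ty m).isF = true) where
  h0 := I.h0
  hp := I.hp
  hin := I.hin
  hn := I.hn
  hpi := I.hpi
  deg := I.deg
  dom := by
    intro j hj _
    by_cases h : j < i ∨ ty j ≠ VTy.F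
    · obtain ⟨d, hd, hh⟩ := I.dom j hj h
      exact ⟨d, Finset.mem_union_left _ hd, hh⟩
    · push Not at h
      exact ⟨j, Finset.mem_union_right _ (Finset.mem_filter.mpr ⟨Finset.mem_Ico.mpr ⟨h.1, hj⟩, by rw [h.2]; rfl⟩), hj, Or.inl rfl⟩
  paid := by
    intro j hj hjn h
    apply I.paid j hj hjn
    cases h' : ty j <;> simp [h', VTy.close] at h ⊢
  hub := by
    intro j hj hjn h
    apply Finset.mem_union_left
    apply I.hub j hj hjn
    cases h' : ty j <;> simp [h', VTy.close] at h ⊢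
  bal := by
    have h1 := Finset.card_union_le D ((Finset.Ico i n).filter fun m => (ty m).isF = true)
    have h2 : ((Finset.Ico i n).filter fun m => (ty m).isF = true).card
        = ∑ m ∈ Finset.Ico i n, (ty m).f := by
      rw [Finset.card_filter]
      apply Finset.sum_congr rfl
      intro m _
      cases ty m <;> simp [VTy.isF, VTy.f]
    have h3 : ∑ m ∈ Finset.Ico i n, (ty m).close.w = ∑ m ∈ Finset.Ico i n, (ty m).w := by
      apply Finset.sum_congr rfl
      intro m _
      cases ty m <;> rfl
    rw [h3]
    have := I.bal
    omega

lemma domNum_le {par : ℕ → ℕ} {n : ℕ} (D : Finset ℕ) (h : ∀ j < n, dm par n D j) :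
    domNum (tg par n) ≤ D.card := by
  let E : Finset (Fin n) := Finset.univ.filter fun v => (v : ℕ) ∈ D
  have hE : IsDomSet (tg par n) ↑E := by
    intro v
    obtain ⟨d, hd, hn, hh⟩ := h v v.2
    by_cases e : d = v
    · left; simp [E, ← e, hd]
    · right
      refine ⟨⟨d, hn⟩, by simp [E, hd], ?_, ?_⟩
      · intro e'; exact e (congrArg Fin.val e')
      · rcases hh with hh | hh | hh
        · exact absurd hh e
        · exact Or.inr hh
        · exact Or.inl hh
  have h1 : domNum (tg par n) ≤ E.card := Nat.sInf_le ⟨E, hE, rfl⟩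
  refine h1.trans ?_
  rw [← Finset.card_map Fin.valEmbedding]
  apply Finset.card_le_card
  intro x hx
  simp only [Finset.mem_map, E, Finset.mem_filter] at hx
  obtain ⟨v, hv, rfl⟩ := hx
  exact hv.2

lemma le_domNum {par : ℕ → ℕ} {n : ℕ}
    (deg : ∀ j, ((Finset.range n).filter fun m => par m = j).card ≤ 4) :
    n ≤ 6 * domNum (tg par n) := by
  have hne : {k | ∃ D : Finset (Fin n), IsDomSet (tg par n) ↑D ∧ D.card = k}.Nonempty :=
    ⟨_, Finset.univ, fun v => Or.inl (by simp), rfl⟩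
  obtain ⟨D, hD, hc⟩ := Nat.sInf_mem hne
  change D.card = domNum (tg par n) at hc
  rw [← hc]
  have hsub : Finset.range n ⊆ D.biUnion fun u =>
      ({(u : ℕ), par u} : Finset ℕ) ∪ (Finset.range n).filter fun m => par m = u := by
    intro x hx
    have hx' := Finset.mem_range.mp hx
    simp only [Finset.mem_biUnion, Finset.mem_union, Finset.mem_insert, Finset.mem_singleton,
      Finset.mem_filter, Finset.mem_range]
    rcases hD ⟨x, hx'⟩ with h | ⟨u, hu, _, h⟩
    · exact ⟨⟨x, hx'⟩, h, Or.inl (Or.inl rfl)⟩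
    · refine ⟨u, hu, ?_⟩
      rcases h with h | h
      · exact Or.inr ⟨hx', h⟩
      · exact Or.inl (Or.inr h.symm)
  have := Finset.card_le_card hsub
  rw [Finset.card_range] at this
  refine this.trans (Finset.card_biUnion_le.trans ?_)
  refine (Finset.sum_le_card_nsmul _ _ 6 ?_).trans (by simp [mul_comm])
  intro u _
  refine (Finset.card_union_le _ _).trans ?_
  have h1 := deg u
  have h2 : ({(u : ℕ), par u} : Finset ℕ).card ≤ 2 := Finset.card_le_two
  omega

/-- Lower bound of 2 (asymptotically) for any deterministic online
algorithm on trees: for every always-dominating online algorithm, every `ε > 0` and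
every `M`, there is a tree (with a valid revelation order, here the natural order on
`Fin n`) with domination number at least `M` on which the algorithm selects at least
`(2 - ε)·γ` vertices. -/
theorem tree_lower_bound (A : List (Set ℕ) → Bool) (hA : AlwaysDominating A)
    (ε : ℝ) (hε : 0 < ε) (M : ℕ) :
    ∃ (n : ℕ) (G : SimpleGraph (Fin n)), G.IsTree ∧ PrefixConnected G ∧
      M ≤ domNum G ∧
      (2 - ε) * (domNum G : ℝ) ≤ ((algOutput A G).card : ℝ) := by
  obtain ⟨K, hK⟩ := exists_nat_ge (4 / ε)
  obtain ⟨n, par, ty, D, I, _, hu⟩ := main_phase hA (6 * (M + K))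
  have I2 := I.close hu
  obtain ⟨n', par', ty', hn', J⟩ := closing hA 4 _ _ _ _ _ _ I2 (by
    apply Finset.sum_eq_zero
    intro m _
    cases ty m <;> rfl) le_rfl
  refine ⟨n', tg par' n', tg_tree J.h0 J.hp n' J.hn, tg_prefix J.hp n', ?_, ?_⟩
  · have := le_domNum J.deg
    omega
  · have h1 := le_domNum J.deg
    have h2 := domNum_le _ (fun j hj => J.dom j hj (Or.inl hj))
    have h3 := J.bal
    rw [← card_algOutput] at h3
    simp only [Finset.Ico_self, Finset.sum_empty] at h3
    have h4 : 2 * domNum (tg par' n') ≤ (algOutput A (tg par' n')).card + 4 := by omega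
    have h5 : K ≤ domNum (tg par' n') := by omega
    have h4' : 2 * (domNum (tg par' n') : ℝ) ≤ (algOutput A (tg par' n')).card + 4 := by
      exact_mod_cast h4
    have h5' : (K : ℝ) ≤ domNum (tg par' n') := by exact_mod_cast h5
    have h6 : 4 ≤ ε * domNum (tg par' n') := by
      have := (div_le_iff₀ hε).mp (hK.trans h5')
      linarith
    linarith
end

section
/- For every finite tree T and every revelation order v_1,…,v_n of its vertices in which every prefix {v_1,…,v_i} induces a connected subgraph, the set S of vertices selected by the algorithm 2-DOMINATE is a dominating set of T and satisfies |S| ≤ 2·γ(T). -/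
open SimpleGraph

attribute [local instance] Classical.propDecidable

/-- Closed neighborhood of a finite set of vertices. -/
noncomputable def closedN {n : ℕ} (G : SimpleGraph (Fin n)) (A : Finset (Fin n)) :
    Finset (Fin n) :=
  Finset.univ.filter fun v => v ∈ A ∨ ∃ u ∈ A, G.Adj u v

/-- `R_i`: the vertices revealed by time `i`. -/
noncomputable def Rset (n : ℕ) (i : ℕ) : Finset (Fin n) :=
  Finset.univ.filter fun v => (v : ℕ) ≤ i

/-- `U_i`: visible vertices undominated just before the decision at time `i`,
given the set `Sprev` of previously selected vertices. -/
noncomputable def Uset {n : ℕ} (G : SimpleGraph (Fin n)) (i : ℕ) (Sprev : Finset (Fin n)) :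
    Finset (Fin n) :=
  closedN G (Rset n i) \ closedN G Sprev

/-- The open neighborhood of a vertex, as a finset. -/
noncomputable def nbrs {n : ℕ} (G : SimpleGraph (Fin n)) (v : Fin n) : Finset (Fin n) :=
  Finset.univ.filter fun w => G.Adj v w

/-- The degree of a vertex. -/
noncomputable def deg {n : ℕ} (G : SimpleGraph (Fin n)) (v : Fin n) : ℕ := (nbrs G v).card

/-- `vj` saves `vm`: `vj` is the last vertex of `N[vm]` in the revelation order and
`N[vm] \ {vj}` contains no previously selected vertex. -/
def Saves {n : ℕ} (G : SimpleGraph (Fin n)) (Sprev : Finset (Fin n)) (vj vm : Fin n) : Prop :=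
  (vj = vm ∨ G.Adj vm vj) ∧
  (∀ w : Fin n, (w = vm ∨ G.Adj vm w) → (w : ℕ) ≤ (vj : ℕ)) ∧
  (∀ w : Fin n, (w = vm ∨ G.Adj vm w) → w ≠ vj → w ∉ Sprev)

/-- Decision of `k`-DOMINATE at vertex `vi` with previously selected set `Sprev`:
select iff `vi` has at least `k` undominated neighbors, or `vi` saves some vertex. -/
def kDomDecision {n : ℕ} (G : SimpleGraph (Fin n)) (k : ℕ) (vi : Fin n)
    (Sprev : Finset (Fin n)) : Prop :=
  k ≤ (nbrs G vi ∩ Uset G (vi : ℕ) Sprev).card ∨ ∃ vm : Fin n, Saves G Sprev vi vm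

/-- The set of vertices selected by `k`-DOMINATE after the first `i` decisions. -/
noncomputable def kDomStep {n : ℕ} (G : SimpleGraph (Fin n)) (k : ℕ) : ℕ → Finset (Fin n)
  | 0 => ∅
  | i + 1 =>
    kDomStep G k i ∪
      if h : i < n then
        if kDomDecision G k ⟨i, h⟩ (kDomStep G k i) then {⟨i, h⟩} else ∅
      else ∅

/-- The output of the online algorithm `k`-DOMINATE. -/
noncomputable def kDomOutput {n : ℕ} (G : SimpleGraph (Fin n)) (k : ℕ) : Finset (Fin n) :=
  kDomStep G k n

namespace TwoDom

noncomputable def ch {n : ℕ} (G : SimpleGraph (Fin n)) (v : Fin n) : Finset (Fin n) :=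
  Finset.univ.filter fun w => G.Adj v w ∧ v < w

def strong {n : ℕ} (G : SimpleGraph (Fin n)) (S : Finset (Fin n)) (v : Fin n) : Prop :=
  2 ≤ (ch G v).card ∨ ∃ u ∈ S, G.Adj u v ∧ u < v

noncomputable def phi {n : ℕ} (G : SimpleGraph (Fin n)) (S D : Finset (Fin n)) (v : Fin n) : ℤ :=
  if v ∈ D then 1 else
    (if ∃ c ∈ ch G v, c ∈ D then 0 else -1) + (if strong G S v then 1 else 0)

lemma local_ineq {n : ℕ} (G : SimpleGraph (Fin n)) (S D : Finset (Fin n))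
    (hD : IsDomSet G (D : Set (Fin n)))
    (huniq : ∀ u w v : Fin n, G.Adj u v → u < v → G.Adj w v → w < v → u = w)
    (h2 : ∀ v, 2 ≤ (ch G v).card → v ∈ S)
    (h3 : ∀ u v, u ∈ S → G.Adj u v → u < v → (ch G v).card ≤ 1 → v ∉ S) (v : Fin n) :
    phi G S D v ≤ 2 * (if v ∈ D then 1 else 0) - (if v ∈ S then 1 else 0)
      + ∑ c ∈ ch G v, phi G S D c := by
  have hm1 : ∀ c, -1 ≤ phi G S D c := by
    intro c; unfold phi; split_ifs <;> norm_num
  have hs0 : ∀ c, strong G S c → 0 ≤ phi G S D c := by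
    intro c h; unfold phi; simp only [h, if_true]; split_ifs <;> norm_num
  have hchS : ∀ c ∈ ch G v, v ∈ S → strong G S c := by
    intro c hc hv
    simp only [ch, Finset.mem_filter, Finset.mem_univ, true_and] at hc
    exact Or.inr ⟨v, hv, hc.1, hc.2⟩
  have hdom : ∀ c ∈ ch G v, v ∉ D → c ∈ D ∨ ∃ c' ∈ ch G c, c' ∈ D := by
    intro c hc hv
    simp only [ch, Finset.mem_filter, Finset.mem_univ, true_and] at hc
    rcases hD c with h | ⟨u, hu, huc⟩
    · exact Or.inl h
    · right
      refine ⟨u, ?_, hu⟩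
      simp only [ch, Finset.mem_filter, Finset.mem_univ, true_and]
      refine ⟨huc.symm, ?_⟩
      by_contra hlt
      have hne : u ≠ c := huc.ne
      have : u < c := lt_of_le_of_ne (not_lt.mp hlt) hne
      have := huniq u v c huc this hc.1 hc.2
      subst this
      exact hv hu
  have h0 : ∀ c ∈ ch G v, v ∉ D → 0 ≤ phi G S D c := by
    intro c hc hv
    unfold phi
    rcases hdom c hc hv with h | h
    · simp [h]
    · simp only [h, if_true]; split_ifs <;> norm_num
  have h1 : ∀ c ∈ ch G v, v ∉ D → v ∈ S → 1 ≤ phi G S D c := by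
    intro c hc hv hvS
    have := hchS c hc hvS
    unfold phi
    rcases hdom c hc hv with h | h
    · simp [h]
    · simp only [h, this, if_true]; split_ifs <;> norm_num
  by_cases hvS : v ∈ S
  · by_cases hvD : v ∈ D
    · have : 0 ≤ ∑ c ∈ ch G v, phi G S D c :=
        Finset.sum_nonneg fun c hc => hs0 c (hchS c hc hvS)
      have e : phi G S D v = 1 := by simp [phi, hvD]
      simp only [e, hvS, hvD, if_true]; linarith
    · have hsum : ((ch G v).card : ℤ) ≤ ∑ c ∈ ch G v, phi G S D c := by
        have := Finset.card_nsmul_le_sum (ch G v) (phi G S D) 1 (fun c hc => h1 c hc hvD hvS)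
        simpa using this
      have hst : strong G S v → 2 ≤ (ch G v).card := by
        rintro (h | ⟨u, hu, ha, hl⟩)
        · exact h
        · by_contra hh
          exact h3 u v hu ha hl (by omega) hvS
      have hex : (∃ c ∈ ch G v, c ∈ D) → 1 ≤ (ch G v).card := by
        rintro ⟨c, hc, _⟩
        exact Finset.card_pos.mpr ⟨c, hc⟩
      unfold phi at hsum ⊢
      simp only [hvS, hvD, if_true, if_false]
      split_ifs with ha hb hb
      · have := hst hb; omega
      · have := hex ha; omega
      · have := hst hb; omega
      · omega
  · have hc1 : (ch G v).card ≤ 1 := by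
      by_contra h; exact hvS (h2 v (by omega))
    rcases Finset.eq_empty_or_nonempty (ch G v) with he | ⟨c, hc⟩
    · simp only [he, Finset.sum_empty, hvS]
      unfold phi
      rw [he]
      split_ifs <;> simp_all
    · have he : ch G v = {c} := Finset.eq_singleton_iff_unique_mem.mpr
        ⟨hc, fun x hx => Finset.card_le_one.mp hc1 x hx c hc⟩
      rw [he, Finset.sum_singleton]
      have hA := hm1 c
      by_cases hvD : v ∈ D
      · have e : phi G S D v = 1 := by simp [phi, hvD]
        simp only [e, hvS, hvD, if_true, if_false]; linarith
      · have hB := h0 c hc hvD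
        simp only [hvS, hvD, if_false]
        by_cases hcD : c ∈ D
        · have e : phi G S D c = 1 := by simp [phi, hcD]
          rw [e]
          unfold phi
          split_ifs <;> norm_num
        · have : phi G S D v ≤ 0 := by
            unfold phi
            rw [he]
            simp only [hvD, hcD, if_false, Finset.mem_singleton, exists_eq_left]
            split_ifs <;> norm_num
          linarith

lemma card_bound {n : ℕ} (hn : 0 < n) (G : SimpleGraph (Fin n)) (S D : Finset (Fin n))
    (hD : IsDomSet G (D : Set (Fin n)))
    (huniq : ∀ u w v : Fin n, G.Adj u v → u < v → G.Adj w v → w < v → u = w)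
    (hex : ∀ v : Fin n, 0 < (v : ℕ) → ∃ u, G.Adj u v ∧ u < v)
    (h2 : ∀ v, 2 ≤ (ch G v).card → v ∈ S)
    (h3 : ∀ u v, u ∈ S → G.Adj u v → u < v → (ch G v).card ≤ 1 → v ∉ S) :
    S.card ≤ 2 * D.card := by
  have hsum := Finset.sum_le_sum (s := Finset.univ)
    fun v _ => local_ineq G S D hD huniq h2 h3 v
  have hdc : ∑ v : Fin n, ∑ c ∈ ch G v, phi G S D c
      = ∑ c : Fin n, (if c = ⟨0, hn⟩ then 0 else phi G S D c) := by
    simp only [ch, Finset.sum_filter]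
    rw [Finset.sum_comm]
    refine Finset.sum_congr rfl fun c _ => ?_
    split_ifs with h
    · subst h
      refine Finset.sum_eq_zero fun x _ => ?_
      rw [if_neg]
      rintro ⟨_, hx⟩
      exact absurd hx (Nat.not_lt_zero _)
    · obtain ⟨u, hu, hl⟩ := hex c (Nat.pos_of_ne_zero fun h' => h (Fin.ext h'))
      rw [Finset.sum_eq_single u]
      · rw [if_pos ⟨hu, hl⟩]
      · intro w _ hw
        rw [if_neg]
        rintro ⟨ha, hb⟩
        exact hw (huniq w u c ha hb hu hl)
      · simp
  have hroot : 0 ≤ phi G S D ⟨0, hn⟩ := by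
    unfold phi
    rcases hD ⟨0, hn⟩ with h | ⟨u, hu, ha⟩
    · have : (⟨0, hn⟩ : Fin n) ∈ D := h
      simp [this]
    · have : ∃ c ∈ ch G ⟨0, hn⟩, c ∈ D := by
        refine ⟨u, ?_, hu⟩
        simp only [ch, Finset.mem_filter, Finset.mem_univ, true_and]
        refine ⟨ha.symm, ?_⟩
        exact lt_of_le_of_ne (Nat.zero_le _) ha.ne.symm
      simp only [this, if_true]
      split_ifs <;> norm_num
  have hsplit : ∑ c : Fin n, phi G S D c
      = ∑ c : Fin n, (if c = ⟨0, hn⟩ then 0 else phi G S D c) + phi G S D ⟨0, hn⟩ := by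
    have : phi G S D ⟨0, hn⟩ = ∑ c : Fin n, (if c = ⟨0, hn⟩ then phi G S D c else 0) := by simp
    rw [this, ← Finset.sum_add_distrib]
    refine Finset.sum_congr rfl fun c _ => ?_
    split_ifs <;> simp
  rw [Finset.sum_add_distrib, Finset.sum_sub_distrib, ← Finset.mul_sum, hdc] at hsum
  simp only [Finset.sum_ite_mem, Finset.univ_inter, Finset.sum_const, nsmul_eq_mul, mul_one] at hsum
  zify
  linarith

lemma parent_ex {n : ℕ} (G : SimpleGraph (Fin n)) (hpc : PrefixConnected G)
    (v : Fin n) (hv : 0 < (v : ℕ)) : ∃ u, G.Adj u v ∧ u < v := by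
  have hc := hpc v
  have : Nontrivial {w : Fin n | w ≤ v} :=
    ⟨⟨⟨⟨0, by omega⟩, Nat.zero_le _⟩, ⟨v, le_refl v⟩, by
      intro h
      have := congrArg (fun x => (x.1 : ℕ)) h
      simp at this; omega⟩⟩
  obtain ⟨w, hw⟩ := hc.preconnected.exists_adj_of_nontrivial ⟨v, le_refl v⟩
  have ha : G.Adj v w.1 := hw
  exact ⟨w.1, ha.symm, lt_of_le_of_ne w.2 ha.ne.symm⟩

lemma parent_uniq {n : ℕ} (G : SimpleGraph (Fin n)) (hT : G.IsTree) (hpc : PrefixConnected G)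
    (u w v : Fin n) (hu : G.Adj u v) (hul : u < v) (hw : G.Adj w v) (hwl : w < v) : u = w := by
  by_contra hne
  have hv : 0 < (v : ℕ) := lt_of_le_of_lt (Nat.zero_le _) hul
  let i : Fin n := ⟨(v : ℕ) - 1, by omega⟩
  have hle : ∀ x : Fin n, x < v → x ≤ i := fun x hx => by
    show (x : ℕ) ≤ (v : ℕ) - 1
    have : (x : ℕ) < v := hx
    omega
  obtain ⟨q, hq⟩ := ((hpc i).preconnected ⟨u, hle u hul⟩ ⟨w, hle w hwl⟩).exists_isPath
  let q' : G.Walk u w := q.map (SimpleGraph.Embedding.induce {x : Fin n | x ≤ i}).toHom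
  have hq' : q'.IsPath := SimpleGraph.Walk.map_isPath_of_injective
    (SimpleGraph.Embedding.induce (G := G) {x : Fin n | x ≤ i}).injective hq
  have hnv : v ∉ q'.support := by
    intro hmem
    have hs := SimpleGraph.Walk.support_map
      (SimpleGraph.Embedding.induce (G := G) {x : Fin n | x ≤ i}).toHom q
    have hmem' := hs ▸ hmem
    obtain ⟨x, _, hx⟩ := List.mem_map.mp hmem'
    have h1 : (x.1 : ℕ) ≤ (v : ℕ) - 1 := x.2
    have h2 : x.1 = v := hx
    rw [h2] at h1
    omega
  let r : G.Walk u w := SimpleGraph.Walk.cons hu (SimpleGraph.Walk.cons hw.symm SimpleGraph.Walk.nil)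
  have hr : r.IsPath := by
    simp [r, SimpleGraph.Walk.cons_isPath_iff, hne, hu.ne, hw.ne.symm]
  have := hT.isAcyclic.path_unique ⟨q', hq'⟩ ⟨r, hr⟩
  have h := congrArg Subtype.val this
  have : v ∈ q'.support := by
    have h' : q' = r := h
    rw [h']; simp [r]
  exact hnv this

lemma mem_step {n : ℕ} (G : SimpleGraph (Fin n)) (k i : ℕ) (v : Fin n) :
    v ∈ kDomStep G k i ↔ (v : ℕ) < i ∧ kDomDecision G k v (kDomStep G k v) := by
  induction i with
  | zero => simp [kDomStep]
  | succ i ih =>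
    rw [kDomStep, Finset.mem_union, ih]
    constructor
    · rintro (⟨h, h'⟩ | h)
      · exact ⟨by omega, h'⟩
      · split_ifs at h with h1 h2
        · have := Finset.mem_singleton.mp h
          subst this
          exact ⟨Nat.lt_succ_self _, h2⟩
        · simp at h
        · simp at h
    · rintro ⟨h, h'⟩
      by_cases hvi : (v : ℕ) < i
      · exact Or.inl ⟨hvi, h'⟩
      · have e : (v : ℕ) = i := by omega
        subst e
        right
        rw [dif_pos v.2, if_pos h']
        simp

lemma mem_out {n : ℕ} (G : SimpleGraph (Fin n)) (k : ℕ) (v : Fin n) :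
    v ∈ kDomOutput G k ↔ kDomDecision G k v (kDomStep G k v) := by
  unfold kDomOutput
  rw [mem_step]
  simp

lemma mem_step' {n : ℕ} (G : SimpleGraph (Fin n)) (k i : ℕ) (v : Fin n) :
    v ∈ kDomStep G k i ↔ (v : ℕ) < i ∧ v ∈ kDomOutput G k := by
  rw [mem_step, mem_out]

lemma dominating {n : ℕ} (G : SimpleGraph (Fin n)) (k : ℕ) :
    IsDomSet G (kDomOutput G k : Set (Fin n)) := by
  intro v
  by_contra hcon
  push Not at hcon
  obtain ⟨hv, hadj⟩ := hcon
  have hno : ∀ w, (w = v ∨ G.Adj v w) → w ∉ kDomOutput G k := by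
    rintro w (rfl | h) hw
    · exact hv hw
    · exact hadj w hw h.symm
  obtain ⟨j, hj, hmax⟩ := Finset.exists_max_image
    (Finset.univ.filter fun w => w = v ∨ G.Adj v w) (fun w => (w : ℕ)) ⟨v, by simp⟩
  simp only [Finset.mem_filter, Finset.mem_univ, true_and] at hj hmax
  refine hno j hj ((mem_out G k j).mpr (Or.inr ⟨v, hj, hmax, ?_⟩))
  intro w hw _ hws
  exact hno w hw ((mem_step' G k _ w).mp hws).2

end TwoDom

/-- On every tree revealed with connected prefixes, 2-DOMINATE outputs a
dominating set of size at most `2·γ(T)`. -/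
theorem two_dominate_trees {n : ℕ} (G : SimpleGraph (Fin n)) (hT : G.IsTree)
    (hpc : PrefixConnected G) :
    IsDomSet G ↑(kDomOutput G 2) ∧ (kDomOutput G 2).card ≤ 2 * domNum G := by
  have huniq := TwoDom.parent_uniq G hT hpc
  have hn : 0 < n := by
    obtain ⟨x⟩ := hT.connected.nonempty
    exact lt_of_le_of_lt (Nat.zero_le _) x.2
  refine ⟨TwoDom.dominating G 2, ?_⟩
  have hne : {k | ∃ D : Finset (Fin n), IsDomSet G ↑D ∧ D.card = k}.Nonempty :=
    ⟨_, _, TwoDom.dominating G 2, rfl⟩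
  obtain ⟨D, hD, hcard⟩ := Nat.sInf_mem hne
  have hdn : domNum G = D.card := hcard.symm
  rw [hdn]
  refine TwoDom.card_bound hn G _ D hD huniq (TwoDom.parent_ex G hpc) ?_ ?_
  · intro v hv
    rw [TwoDom.mem_out]
    left
    refine hv.trans (Finset.card_le_card ?_)
    intro c hc
    simp only [TwoDom.ch, Finset.mem_filter, Finset.mem_univ, true_and] at hc
    simp only [Finset.mem_inter, nbrs, Uset, closedN, Rset, Finset.mem_sdiff,
      Finset.mem_filter, Finset.mem_univ, true_and]
    refine ⟨hc.1, Or.inr ⟨v, le_refl _, hc.1⟩, ?_⟩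
    have hvc : (v : ℕ) < c := hc.2
    rintro (h | ⟨u, hu, ha⟩)
    · have := ((TwoDom.mem_step' G 2 _ c).mp h).1
      omega
    · have huv := ((TwoDom.mem_step' G 2 _ u).mp hu).1
      have hlt : u < c := by
        show (u : ℕ) < c
        omega
      have := huniq u v c ha hlt hc.1 hc.2
      subst this
      omega
  · intro u v hu ha hl hcard hv
    have huS : u ∈ kDomStep G 2 v := (TwoDom.mem_step' G 2 _ u).mpr ⟨hl, hu⟩
    rw [TwoDom.mem_out] at hv
    rcases hv with h | ⟨m, hm1, hm2, hm3⟩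
    · have hsub : nbrs G v ∩ Uset G (v : ℕ) (kDomStep G 2 v) ⊆ TwoDom.ch G v := by
        intro c hc
        simp only [Finset.mem_inter, nbrs, Uset, closedN, Rset, Finset.mem_sdiff,
          Finset.mem_filter, Finset.mem_univ, true_and] at hc
        obtain ⟨hvc, _, hnd⟩ := hc
        simp only [TwoDom.ch, Finset.mem_filter, Finset.mem_univ, true_and]
        refine ⟨hvc, ?_⟩
        by_contra hlt
        have hcv : c < v := lt_of_le_of_ne (not_lt.mp hlt) hvc.ne.symm
        have := huniq c u v hvc.symm hcv ha hl
        subst this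
        exact hnd (Or.inl huS)
      have := Finset.card_le_card hsub
      omega
    · rcases hm1 with rfl | hadj
      · exact hm3 u (Or.inr ha.symm) ha.ne huS
      · have hmv : m < v := lt_of_le_of_ne (hm2 m (Or.inl rfl)) hadj.ne
        have := huniq m u v hadj hmv ha hl
        subst this
        exact hm3 m (Or.inl rfl) ha.ne huS
end

section
/- Suppose a finite tree T is revealed in an order v_1,…,v_n in which every prefix {v_1,…,v_i} induces a connected subgraph, and the algorithm 2-DOMINATE is run on this input. Then every vertex v_i with degree at least 3 in T is selected by 2-DOMINATE. -/
open SimpleGraph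

attribute [local instance] Classical.propDecidable

/-- In a tree with connected prefixes, each vertex has at most one earlier neighbor. -/
lemma earlier_nbr_unique {n : ℕ} (G : SimpleGraph (Fin n)) (hT : G.IsTree)
    (hpc : PrefixConnected G) (w a b : Fin n) (ha : a < w) (hb : b < w)
    (hwa : G.Adj w a) (hwb : G.Adj w b) : a = b := by
  by_contra hab
  have hw : (w : ℕ) - 1 < n := by omega
  have hc := hpc ⟨(w : ℕ) - 1, hw⟩
  have ha' : a ∈ {v : Fin n | v ≤ ⟨(w : ℕ) - 1, hw⟩} := by
    simp only [Set.mem_ofPred_eq, Fin.le_def]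
    have := Fin.lt_def.mp ha
    omega
  have hb' : b ∈ {v : Fin n | v ≤ ⟨(w : ℕ) - 1, hw⟩} := by
    simp only [Set.mem_ofPred_eq, Fin.le_def]
    have := Fin.lt_def.mp hb
    omega
  obtain ⟨p, hp⟩ := (hc.preconnected ⟨a, ha'⟩ ⟨b, hb'⟩).exists_isPath
  let f := (SimpleGraph.Embedding.induce (G := G)
    {v : Fin n | v ≤ ⟨(w : ℕ) - 1, hw⟩}).toHom
  have hq : (p.map f).IsPath := SimpleGraph.Walk.map_isPath_of_injective
    Subtype.val_injective hp
  let r : G.Walk a b := .cons hwa.symm (.cons hwb .nil)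
  have hr : r.IsPath := by
    simp [r, SimpleGraph.Walk.cons_isPath_iff, hab, ha.ne, hb.ne']
  have heq := hT.isAcyclic.path_unique ⟨p.map f, hq⟩ ⟨r, hr⟩
  have heq' : p.map f = r := congrArg Subtype.val heq
  have hmem : w ∈ (p.map f).support := by
    rw [heq']
    exact List.mem_cons_of_mem _ (List.mem_cons_self)
  rw [SimpleGraph.Walk.support_map, List.mem_map] at hmem
  obtain ⟨x, -, hx⟩ := hmem
  have h1 : (x : Fin n) = w := hx
  have h2 := x.2
  simp only [Set.mem_ofPred_eq, Fin.le_def, h1] at h2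
  have := Fin.lt_def.mp ha
  omega

lemma kDomStep_lt {n : ℕ} (G : SimpleGraph (Fin n)) (k i : ℕ) (u : Fin n)
    (hu : u ∈ kDomStep G k i) : (u : ℕ) < i := by
  induction i with
  | zero => simp [kDomStep] at hu
  | succ i ih =>
    rw [kDomStep, Finset.mem_union] at hu
    rcases hu with hu | hu
    · have := ih hu
      omega
    · split_ifs at hu
      · rw [Finset.mem_singleton] at hu
        simp [hu]
      · simp at hu
      · simp at hu

lemma kDomStep_mono {n : ℕ} (G : SimpleGraph (Fin n)) (k : ℕ) : Monotone (kDomStep G k) :=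
  monotone_nat_of_le_succ fun i => by
    rw [kDomStep]
    exact Finset.subset_union_left

/-- When 2-DOMINATE runs on a tree revealed with connected prefixes,
every vertex of degree at least 3 is selected. -/
theorem two_dominate_selects_deg_three {n : ℕ} (G : SimpleGraph (Fin n)) (hT : G.IsTree)
    (hpc : PrefixConnected G) (v : Fin n) (hdeg : 3 ≤ deg G v) :
    v ∈ kDomOutput G 2 := by
  have hdec : kDomDecision G 2 v (kDomStep G 2 v) := by
    left
    have hsub : (nbrs G v).filter (fun w => v < w) ⊆
        nbrs G v ∩ Uset G (v : ℕ) (kDomStep G 2 v) := by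
      intro w hw
      rw [Finset.mem_filter] at hw
      obtain ⟨hw, hvw⟩ := hw
      refine Finset.mem_inter.mpr ⟨hw, ?_⟩
      have hadj : G.Adj v w := by simpa [nbrs] using hw
      have hvw' := Fin.lt_def.mp hvw
      rw [Uset, Finset.mem_sdiff]
      constructor
      · simp only [closedN, Finset.mem_filter, Finset.mem_univ, true_and]
        exact Or.inr ⟨v, by simp [Rset], hadj⟩
      · simp only [closedN, Finset.mem_filter, Finset.mem_univ, true_and]
        rintro (h | ⟨u, hu, huw⟩)
        · have := kDomStep_lt G 2 _ _ h
          omega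
        · have hlt := kDomStep_lt G 2 _ _ hu
          have := earlier_nbr_unique G hT hpc w u v (Fin.lt_def.mpr (by omega)) hvw
            huw.symm hadj.symm
          subst this
          omega
    refine le_trans ?_ (Finset.card_le_card hsub)
    have hle : ((nbrs G v).filter (fun w => ¬ v < w)).card ≤ 1 := by
      rw [Finset.card_le_one]
      intro a ha b hb
      simp only [nbrs, Finset.mem_filter, Finset.mem_univ, true_and, not_lt] at ha hb
      exact earlier_nbr_unique G hT hpc v a b (lt_of_le_of_ne ha.2 ha.1.ne')
        (lt_of_le_of_ne hb.2 hb.1.ne') ha.1 hb.1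
    have hsum := Finset.card_filter_add_card_filter_not (s := nbrs G v) (fun w => v < w)
    have hd : 3 ≤ (nbrs G v).card := hdeg
    omega
  have hmem : v ∈ kDomStep G 2 ((v : ℕ) + 1) := by
    rw [kDomStep, Finset.mem_union]
    right
    rw [dif_pos v.2, if_pos hdec]
    simp
  exact kDomStep_mono G 2 (Nat.succ_le_of_lt v.2) hmem
end

section
/- For every cactus graph G and every revelation order v_1,…,v_n of its vertices in which every prefix {v_1,…,v_i} induces a connected subgraph, the set S of vertices selected by the algorithm 2-DOMINATE is a dominating set of G and satisfies |S| ≤ (5/2)·γ(G). -/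
open SimpleGraph

attribute [local instance] Classical.propDecidable

/-- A cactus graph: connected, and every edge lies on at most one cycle (any two cycles
through a common edge have the same edge set). -/
def IsCactus {V : Type*} (G : SimpleGraph V) : Prop :=
  G.Connected ∧
    ∀ ⦃u v : V⦄ (c₁ : G.Walk u u) (c₂ : G.Walk v v), c₁.IsCycle → c₂.IsCycle →
      ∀ e ∈ c₁.edges, e ∈ c₂.edges → {e' | e' ∈ c₁.edges} = {e' | e' ∈ c₂.edges}

/-- `a` and `b` are joined by a walk avoiding `o`. -/
def Avoid {n : ℕ} (G : SimpleGraph (Fin n)) (o a b : Fin n) : Prop :=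
  ∃ p : G.Walk a b, o ∉ p.support

theorem Avoid.symm' {n : ℕ} {G : SimpleGraph (Fin n)} {o a b : Fin n} (h : Avoid G o a b) :
    Avoid G o b a := by
  obtain ⟨p, hp⟩ := h
  exact ⟨p.reverse, by simpa using hp⟩

theorem Avoid.trans' {n : ℕ} {G : SimpleGraph (Fin n)} {o a b c : Fin n} (h : Avoid G o a b)
    (h' : Avoid G o b c) : Avoid G o a c := by
  obtain ⟨p, hp⟩ := h
  obtain ⟨q, hq⟩ := h'
  exact ⟨p.append q, by simp [Walk.mem_support_append_iff, hp, hq]⟩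

theorem Avoid.step' {n : ℕ} {G : SimpleGraph (Fin n)} {o a b : Fin n} (ha : a ≠ o) (hb : b ≠ o)
    (h : G.Adj a b) : Avoid G o a b :=
  ⟨Walk.cons h Walk.nil, by simp [ha.symm, hb.symm]⟩

theorem cycle_of_avoid {n : ℕ} {G : SimpleGraph (Fin n)} {o a b : Fin n} (ha : G.Adj o a)
    (hb : G.Adj o b) (hab : a ≠ b) (h : Avoid G o a b) :
    ∃ c : G.Walk o o, c.IsCycle ∧ s(o, a) ∈ c.edges ∧ s(o, b) ∈ c.edges ∧
      ∀ x, s(o, x) ∈ c.edges → x = a ∨ x = b := by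
  classical
  obtain ⟨p, hp⟩ := h
  have hq : o ∉ p.bypass.support := fun h => hp (p.support_bypass_subset_support h)
  have hqp : p.bypass.IsPath := p.bypass_isPath
  generalize p.bypass = q at hq hqp
  have he : ∀ x, s(o, x) ∉ q.edges := fun x hx => hq (q.fst_mem_support_of_mem_edges hx)
  refine ⟨Walk.cons ha (q.concat hb.symm), ?_, by simp, ?_, ?_⟩
  · rw [Walk.cons_isCycle_iff]
    refine ⟨hqp.concat hq hb.symm, ?_⟩
    rw [Walk.edges_concat]
    simp only [List.concat_eq_append, List.mem_append, List.mem_singleton, not_or]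
    refine ⟨he a, ?_⟩
    intro h
    rw [Sym2.eq_iff] at h
    rcases h with ⟨h, -⟩ | ⟨-, h⟩
    · exact hb.ne h
    · exact hab h
  · simp [Walk.edges_concat, Sym2.eq_swap]
  · intro x hx
    simp only [Walk.edges_cons, Walk.edges_concat, List.concat_eq_append, List.mem_cons,
      List.mem_append, List.not_mem_nil, or_false] at hx
    rcases hx with h | h | h
    · rw [Sym2.eq_iff] at h
      rcases h with ⟨-, h⟩ | ⟨h, -⟩
      · exact Or.inl h
      · exact absurd h ha.ne
    · exact absurd h (he x)
    · rw [Sym2.eq_iff] at h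
      rcases h with ⟨h, -⟩ | ⟨-, h⟩
      · exact absurd h hb.ne
      · exact Or.inr h

/-- In a cactus, three neighbours of `o` never lie in one component of `G - o`. -/
theorem no_three {n : ℕ} {G : SimpleGraph (Fin n)} (hG : IsCactus G) {o a b c : Fin n}
    (ha : G.Adj o a) (hb : G.Adj o b) (hc : G.Adj o c) (hab : a ≠ b) (hac : a ≠ c) (hbc : b ≠ c)
    (h1 : Avoid G o a b) (h2 : Avoid G o a c) : False := by
  obtain ⟨c1, h1c, h1a, -, h1x⟩ := cycle_of_avoid ha hb hab h1
  obtain ⟨c2, h2c, h2a, h2b, -⟩ := cycle_of_avoid ha hc hac h2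
  have := hG.2 c1 c2 h1c h2c _ h1a h2a
  have h3 : s(o, c) ∈ {e' | e' ∈ c1.edges} := by rw [this]; exact h2b
  rcases h1x c h3 with h | h
  · exact hac h.symm
  · exact hbc h.symm

theorem exists_earlier {n : ℕ} {G : SimpleGraph (Fin n)} (hpc : PrefixConnected G) {u v : Fin n}
    (h : u < v) : ∃ w, w < v ∧ G.Adj v w := by
  obtain ⟨p⟩ := (hpc v).preconnected ⟨v, le_refl v⟩ ⟨u, h.le⟩
  cases p with
  | nil => exact absurd h (lt_irrefl _)
  | cons hadj q =>
    rename_i w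
    have h' : G.Adj v w.1 := hadj
    exact ⟨w.1, lt_of_le_of_ne w.2 h'.ne', h'⟩

theorem avoid_of_lt {n : ℕ} {G : SimpleGraph (Fin n)} (hpc : PrefixConnected G) {o z v : Fin n}
    (hz : ∀ x, z ≤ x) (hv : v < o) : Avoid G o z v := by
  induction v using WellFoundedLT.induction with
  | ind v ih =>
    by_cases hzv : v = z
    · subst hzv
      exact ⟨Walk.nil, by simpa using hv.ne'⟩
    · obtain ⟨w, hw, hvw⟩ := exists_earlier hpc (lt_of_le_of_ne (hz v) (Ne.symm hzv))
      exact (ih w hw (hw.trans hv)).trans'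
        (Avoid.step' (hw.trans hv).ne hv.ne hvw.symm)

theorem mem_step_iff {n : ℕ} (G : SimpleGraph (Fin n)) (k i : ℕ) (v : Fin n) :
    v ∈ kDomStep G k i ↔ (v : ℕ) < i ∧ kDomDecision G k v (kDomStep G k v) := by
  induction i with
  | zero => simp [kDomStep]
  | succ i ih =>
    rw [kDomStep, Finset.mem_union, ih]
    by_cases h : i < n
    · rw [dif_pos h]
      by_cases hv : (v : ℕ) = i
      · subst hv
        by_cases hd : kDomDecision G k v (kDomStep G k v)
        · simp [hd]
        · simp [hd]
      · have hne : v ≠ ⟨i, h⟩ := fun e => hv (by rw [e])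
        have : v ∉ (if kDomDecision G k ⟨i, h⟩ (kDomStep G k i) then ({⟨i, h⟩} : Finset (Fin n))
            else ∅) := by
          split_ifs <;> simp [hne]
        have h2 : (v : ℕ) < i ↔ (v : ℕ) < i + 1 := by omega
        simp only [this, or_false, h2]
    · rw [dif_neg h]
      have h2 : (v : ℕ) < i ↔ (v : ℕ) < i + 1 := by have := v.2; omega
      simp [h2]

theorem step_eq {n : ℕ} (G : SimpleGraph (Fin n)) (k : ℕ) (u v : Fin n) :
    u ∈ kDomStep G k v ↔ u < v ∧ u ∈ kDomOutput G k := by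
  rw [kDomOutput, mem_step_iff, mem_step_iff, Fin.lt_def]
  simp [u.2]

/-- What is needed about the set selected by 2-DOMINATE. -/
structure Good {n : ℕ} (G : SimpleGraph (Fin n)) (S : Finset (Fin n)) (σ : Fin n → Fin n) :
    Prop where
  mem : ∀ x, σ x ∈ S
  nb : ∀ x, σ x = x ∨ G.Adj x (σ x)
  le : ∀ x, ∀ u ∈ S, (u = x ∨ G.Adj x u) → σ x ≤ u
  sel : ∀ v w w', G.Adj v w → G.Adj v w' → w ≠ w' → v ≤ σ w → v ≤ σ w' → v ∈ S
  why : ∀ v ∈ S, (∃ w w', w ≠ w' ∧ σ w = v ∧ σ w' = v) ∨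
    ∃ x, σ x = v ∧ ∀ w, (w = x ∨ G.Adj x w) → w ≤ v

theorem exists_good {n : ℕ} (G : SimpleGraph (Fin n)) : ∃ σ, Good G (kDomOutput G 2) σ := by
  have hS : ∀ v, v ∈ kDomOutput G 2 ↔ kDomDecision G 2 v (kDomStep G 2 v) := by
    intro v
    rw [kDomOutput, mem_step_iff]
    simp [v.2]
  have hst := step_eq G 2
  set S := kDomOutput G 2 with hSdef
  have hU : ∀ v w : Fin n, w ∈ nbrs G v ∩ Uset G (v : ℕ) (kDomStep G 2 v) ↔
      G.Adj v w ∧ ∀ u ∈ S, (u = w ∨ G.Adj w u) → v ≤ u := by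
    intro v w
    simp only [nbrs, Uset, closedN, Rset, Finset.mem_inter, Finset.mem_filter, Finset.mem_univ,
      true_and, Finset.mem_sdiff, hst]
    constructor
    · rintro ⟨h1, -, h3⟩
      refine ⟨h1, fun u hu huw => ?_⟩
      by_contra hlt
      rw [not_le] at hlt
      apply h3
      rcases huw with rfl | huw
      · exact Or.inl ⟨hlt, hu⟩
      · exact Or.inr ⟨u, ⟨hlt, hu⟩, huw.symm⟩
    · rintro ⟨h1, h2⟩
      refine ⟨h1, Or.inr ⟨v, le_refl _, h1⟩, ?_⟩
      rintro (⟨h3, h4⟩ | ⟨u, ⟨h3, h4⟩, h5⟩)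
      · exact absurd (h2 w h4 (Or.inl rfl)) (not_le.mpr h3)
      · exact absurd (h2 u h4 (Or.inr h5.symm)) (not_le.mpr h3)
  -- every vertex is dominated
  have hdom : ∀ x : Fin n, (S.filter fun u => u = x ∨ G.Adj x u).Nonempty := by
    intro x
    by_contra hne
    rw [Finset.not_nonempty_iff_eq_empty] at hne
    have hno : ∀ u, (u = x ∨ G.Adj x u) → u ∉ S := by
      intro u hu huS
      have : u ∈ S.filter fun u => u = x ∨ G.Adj x u := by simp [huS, hu]
      rw [hne] at this
      simp at this
    obtain ⟨m, hm, hmax⟩ := (Finset.univ.filter fun u => u = x ∨ G.Adj x u).exists_max_image id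
      ⟨x, by simp⟩
    simp only [Finset.mem_filter, Finset.mem_univ, true_and, id] at hm hmax
    apply hno m hm
    rw [hS]
    refine Or.inr ⟨x, hm, fun w hw => hmax w hw, fun w hw _ hw' => ?_⟩
    exact hno w hw ((hst w m).1 hw').2
  have hex : ∀ x, ∃ s, s ∈ S ∧ (s = x ∨ G.Adj x s) ∧ ∀ u ∈ S, (u = x ∨ G.Adj x u) → s ≤ u := by
    intro x
    obtain ⟨m, hm, hmin⟩ := (S.filter fun u => u = x ∨ G.Adj x u).exists_min_image id (hdom x)
    simp only [Finset.mem_filter, id] at hm hmin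
    exact ⟨m, hm.1, hm.2, fun u hu hux => hmin u ⟨hu, hux⟩⟩
  choose σ h1 h2 h3 using hex
  refine ⟨σ, h1, h2, h3, ?_, ?_⟩
  · intro v w w' hw hw' hne hv hv'
    rw [hS]
    left
    apply Nat.succ_le_of_lt
    rw [Finset.one_lt_card]
    exact ⟨w, (hU v w).2 ⟨hw, fun u hu huw => hv.trans (h3 w u hu huw)⟩,
      w', (hU v w').2 ⟨hw', fun u hu huw => hv'.trans (h3 w' u hu huw)⟩, hne⟩
  · intro v hv
    rcases (hS v).1 hv with h | ⟨x, hx1, hx2, hx3⟩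
    · left
      obtain ⟨w, hw, w', hw', hne⟩ := Finset.one_lt_card.1 (Nat.lt_of_succ_le h)
      rw [hU] at hw hw'
      exact ⟨w, w', hne, le_antisymm (h3 w v hv (Or.inr hw.1.symm)) (hw.2 _ (h1 w) (h2 w)),
        le_antisymm (h3 w' v hv (Or.inr hw'.1.symm)) (hw'.2 _ (h1 w') (h2 w'))⟩
    · right
      refine ⟨x, ?_, fun w hw => hx2 w hw⟩
      by_contra hne
      have hle : σ x ≤ v := hx2 _ (h2 x)
      exact hx3 (σ x) (h2 x) hne ((hst _ _).2 ⟨lt_of_le_of_ne hle hne, h1 x⟩)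

/-- The charge received by `x`. -/
noncomputable def charge {n : ℕ} (σ : Fin n → Fin n) (x : Fin n) : ℝ :=
  1 / ((Finset.univ.filter fun x' => σ x' = σ x).card : ℝ)

theorem charge_nonneg {n : ℕ} (σ : Fin n → Fin n) (x : Fin n) : 0 ≤ charge σ x := by
  unfold charge; positivity

theorem charge_le_one {n : ℕ} (σ : Fin n → Fin n) (x : Fin n) : charge σ x ≤ 1 := by
  unfold charge
  have : 0 < (Finset.univ.filter fun x' => σ x' = σ x).card := Finset.card_pos.2 ⟨x, by simp⟩
  rw [div_le_one (by exact_mod_cast this)]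
  exact_mod_cast this

theorem charge_le_half {n : ℕ} (σ : Fin n → Fin n) {x a b : Fin n} (hab : a ≠ b)
    (ha : σ a = σ x) (hb : σ b = σ x) : charge σ x ≤ 1 / 2 := by
  unfold charge
  have : 1 < (Finset.univ.filter fun x' => σ x' = σ x).card :=
    Finset.one_lt_card.2 ⟨a, by simp [ha], b, by simp [hb], hab⟩
  have h2 : (2 : ℝ) ≤ ((Finset.univ.filter fun x' => σ x' = σ x).card : ℝ) := by
    exact_mod_cast this
  exact one_div_le_one_div_of_le (by norm_num) h2

theorem charge_class {n : ℕ} (σ : Fin n → Fin n) (s : Fin n) (h : ∃ x, σ x = s) :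
    ∑ x ∈ Finset.univ.filter (fun x => σ x = s), charge σ x = 1 := by
  obtain ⟨x, rfl⟩ := h
  have : ∀ y ∈ Finset.univ.filter (fun y => σ y = σ x), charge σ y =
      1 / ((Finset.univ.filter fun x' => σ x' = σ x).card : ℝ) := by
    intro y hy
    simp only [Finset.mem_filter, Finset.mem_univ, true_and] at hy
    simp only [charge, hy]
  rw [Finset.sum_congr rfl this, Finset.sum_const, nsmul_eq_mul]
  have : 0 < (Finset.univ.filter fun x' => σ x' = σ x).card := Finset.card_pos.2 ⟨x, by simp⟩
  have : ((Finset.univ.filter fun x' => σ x' = σ x).card : ℝ) ≠ 0 := by exact_mod_cast this.ne'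
  field_simp

theorem charge_big {n : ℕ} {G : SimpleGraph (Fin n)} {S : Finset (Fin n)} {σ : Fin n → Fin n}
    (hg : Good G S σ) {x : Fin n} (h : ¬ charge σ x ≤ 1 / 2) :
    ∀ w, (w = x ∨ G.Adj x w) → w ≤ σ x := by
  rcases hg.why (σ x) (hg.mem x) with ⟨w, w', hne, hw, hw'⟩ | ⟨x', hx', hall⟩
  · exact absurd (charge_le_half σ hne hw hw') h
  · by_cases hxx : x' = x
    · subst hxx; exact hall
    · exact absurd (charge_le_half σ hxx hx' rfl) h

/-- The configuration in which `o` and its last undominated neighbour both get a full charge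
does not occur when two neighbours of `o` were dominated earlier. -/
theorem no_bad {n : ℕ} {G : SimpleGraph (Fin n)} (hG : IsCactus G) (hpc : PrefixConnected G)
    {S : Finset (Fin n)} {σ : Fin n → Fin n} (hg : Good G S σ) {o z y p q : Fin n}
    (hz : ∀ x, z ≤ x) (hoS : o ∉ S) (hp : G.Adj o p) (hq : G.Adj o q) (hy : G.Adj o y)
    (hpq : p ≠ q) (hpo : σ p < o) (hqo : σ q < o) (hyo : o ≤ σ y)
    (hco : ¬ charge σ o ≤ 1 / 2) (hcy : ¬ charge σ y ≤ 1 / 2)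
    (hK : ∀ x, G.Adj o x → σ x < o → Avoid G o z x) : False := by
  have hne : σ o ≠ σ y := fun h => hco (charge_le_half σ hy.ne rfl h.symm)
  have hbo := charge_big hg hco
  have hby := charge_big hg hcy
  have hyK : ¬ Avoid G o z y := by
    intro hyK
    have hpK := hK p hp hpo
    have hqK := hK q hq hqo
    refine no_three hG hp hq hy hpq ?_ ?_ (hpK.symm'.trans' hqK) (hpK.symm'.trans' hyK)
    · rintro rfl; exact absurd hpo (not_lt.2 hyo)
    · rintro rfl; exact absurd hqo (not_lt.2 hyo)
  have hzo : z ≠ o := by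
    have := hz (σ p)
    exact (this.trans_lt hpo).ne
  have hY : ∀ v, v ≠ o → ¬ Avoid G o z v → y ≤ v := by
    intro v
    induction v using WellFoundedLT.induction with
    | ind v ih =>
      intro hvo hvK
      have hzv : z ≠ v := by
        rintro rfl
        exact hvK ⟨Walk.nil, by simpa using hvo.symm⟩
      obtain ⟨w, hw, hvw⟩ := exists_earlier hpc (lt_of_le_of_ne (hz v) hzv)
      by_cases hwo : w = o
      · subst hwo
        by_cases hvy : v = y
        · exact hvy.ge
        · exfalso
          apply hvK
          apply hK v hvw.symm
          by_contra hlt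
          exact hoS (hg.sel w v y hvw.symm hy hvy (not_lt.1 hlt) hyo)
      · have hwK : ¬ Avoid G o z w := fun h =>
          hvK (h.trans' (Avoid.step' hwo hvo hvw.symm))
        exact (ih w hw hwo hwK).trans hw.le
  have hyS : y ∈ S := by
    by_cases hdeg : ∃ w, G.Adj y w ∧ w ≠ o
    · obtain ⟨w, hyw, hwo⟩ := hdeg
      refine hg.sel y o w hy.symm hyw hwo.symm (hbo y (Or.inr hy)) ?_
      have hwK : ¬ Avoid G o z w := fun h =>
        hyK (h.trans' (Avoid.step' hwo hy.ne' hyw.symm))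
      have hso : σ w ≠ o := fun h => hoS (h ▸ hg.mem w)
      apply hY _ hso
      rcases hg.nb w with h | h
      · rw [h]; exact hwK
      · exact fun h' => hwK (h'.trans' (Avoid.step' hso hwo h.symm))
    · push Not at hdeg
      rcases hg.nb y with h | h
      · exact h ▸ hg.mem y
      · exact absurd (hdeg _ h ▸ hg.mem y) hoS
  have e1 : σ y = y := le_antisymm (hg.le y y hyS (Or.inl rfl)) (hby y (Or.inl rfl))
  have e2 : σ o = y := le_antisymm (hg.le o y hyS (Or.inr hy)) (hbo y (Or.inr hy))
  exact hne (e2.trans e1.symm)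

theorem local_bound {n : ℕ} {G : SimpleGraph (Fin n)} (hG : IsCactus G) (hpc : PrefixConnected G)
    {S : Finset (Fin n)} {σ : Fin n → Fin n} (hg : Good G S σ) (o : Fin n) :
    charge σ o + ∑ x ∈ nbrs G o, charge σ x ≤ 5 / 2 := by
  obtain ⟨z, hz⟩ : ∃ z : Fin n, ∀ x, z ≤ x := ⟨⟨0, o.pos⟩, fun x => Nat.zero_le _⟩
  have hK : ∀ x, G.Adj o x → σ x < o → Avoid G o z x := by
    intro x hx hlt
    have h1 := avoid_of_lt hpc hz hlt
    rcases hg.nb x with h | h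
    · rwa [h] at h1
    · exact h1.trans' (Avoid.step' hlt.ne hx.ne' h.symm)
  set P := (nbrs G o).filter fun x => σ x < o with hP
  set Q := (nbrs G o).filter fun x => ¬ σ x < o with hQ
  have hsplit : ∑ x ∈ nbrs G o, charge σ x = ∑ x ∈ P, charge σ x + ∑ x ∈ Q, charge σ x :=
    (Finset.sum_filter_add_sum_filter_not _ _ _).symm
  have memP : ∀ x, x ∈ P ↔ G.Adj o x ∧ σ x < o := by intro x; simp [hP, nbrs]
  have memQ : ∀ x, x ∈ Q ↔ G.Adj o x ∧ o ≤ σ x := by intro x; simp [hQ, nbrs]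
  have hPcard : P.card ≤ 2 := by
    by_contra hcon
    obtain ⟨a, b, c, ha, hb, hc, hab, hac, hbc⟩ := Finset.two_lt_card_iff.1 (not_le.1 hcon)
    rw [memP] at ha hb hc
    have hA := (hK a ha.1 ha.2).symm'
    exact no_three hG ha.1 hb.1 hc.1 hab hac hbc (hA.trans' (hK b hb.1 hb.2))
      (hA.trans' (hK c hc.1 hc.2))
  have hPhalf : ∀ x ∈ P, charge σ x ≤ 1 / 2 := by
    intro x hx
    rw [memP] at hx
    by_contra hb
    exact absurd (charge_big hg hb o (Or.inr hx.1.symm)) (not_le.2 hx.2)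
  have hPsum : ∑ x ∈ P, charge σ x ≤ P.card * (1 / 2) := by
    have := Finset.sum_le_card_nsmul P _ _ hPhalf
    rwa [nsmul_eq_mul] at this
  have hPc : (P.card : ℝ) ≤ 2 := by exact_mod_cast hPcard
  have hohalf : σ o < o → charge σ o ≤ 1 / 2 := by
    intro h
    by_contra hb
    exact absurd (charge_big hg hb o (Or.inl rfl)) (not_le.2 h)
  have ho1 := charge_le_one σ o
  rw [hsplit]
  by_cases hoS : o ∈ S
  · have hQσ : ∀ x ∈ Q, σ x = o := by
      intro x hx
      rw [memQ] at hx
      exact le_antisymm (hg.le x o hoS (Or.inr hx.1.symm)) hx.2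
    have hcl : ∑ x ∈ Finset.univ.filter (fun x => σ x = o), charge σ x = 1 := by
      apply charge_class
      rcases hg.why o hoS with ⟨w, -, -, hw, -⟩ | ⟨x, hx, -⟩
      · exact ⟨w, hw⟩
      · exact ⟨x, hx⟩
    rcases lt_or_eq_of_le (hg.le o o hoS (Or.inl rfl)) with hlt | heq
    · have hQs : ∑ x ∈ Q, charge σ x ≤ 1 := by
        rw [← hcl]
        refine Finset.sum_le_sum_of_subset_of_nonneg (fun x hx => ?_)
          (fun x _ _ => charge_nonneg σ x)
        simp [hQσ x hx]
      have := hohalf hlt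
      linarith
    · have hoQ : o ∉ Q := by simp [memQ]
      have hQs : charge σ o + ∑ x ∈ Q, charge σ x ≤ 1 := by
        rw [← hcl, ← Finset.sum_insert hoQ]
        refine Finset.sum_le_sum_of_subset_of_nonneg (fun x hx => ?_)
          (fun x _ _ => charge_nonneg σ x)
        rcases Finset.mem_insert.1 hx with rfl | hx
        · simp [heq]
        · simp [hQσ x hx]
      linarith
  · have hQ1 : Q.card ≤ 1 := by
      rw [Finset.card_le_one]
      intro a ha b hb
      rw [memQ] at ha hb
      by_contra hab
      exact hoS (hg.sel o a b ha.1 hb.1 hab ha.2 hb.2)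
    rcases Nat.le_one_iff_eq_zero_or_eq_one.1 hQ1 with h0 | h1
    · rw [Finset.card_eq_zero.1 h0, Finset.sum_empty]
      linarith
    · obtain ⟨y, hy⟩ := Finset.card_eq_one.1 h1
      rw [hy, Finset.sum_singleton]
      have hyQ : y ∈ Q := by simp [hy]
      rw [memQ] at hyQ
      have hy1 := charge_le_one σ y
      by_cases hco : charge σ o ≤ 1 / 2
      · linarith
      by_cases hcy : charge σ y ≤ 1 / 2
      · linarith
      by_cases hP2 : P.card ≤ 1
      · have : (P.card : ℝ) ≤ 1 := by exact_mod_cast hP2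
        linarith
      · exfalso
        obtain ⟨p, hp, q, hq, hpq⟩ := Finset.one_lt_card.1 (not_le.1 hP2)
        rw [memP] at hp hq
        exact no_bad hG hpc hg hz hoS hp.1 hq.1 hyQ.1 hpq hp.2 hq.2 hyQ.2 hco hcy hK

/-- On every cactus graph revealed with connected prefixes, 2-DOMINATE
outputs a dominating set of size at most `(5/2)·γ(G)`. -/
theorem two_dominate_cactus {n : ℕ} (G : SimpleGraph (Fin n)) (hG : IsCactus G)
    (hpc : PrefixConnected G) :
    IsDomSet G ↑(kDomOutput G 2) ∧
      ((kDomOutput G 2).card : ℝ) ≤ (5 / 2) * (domNum G : ℝ) := by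
  obtain ⟨σ, hg⟩ := exists_good G
  constructor
  · intro v
    rcases hg.nb v with h | h
    · exact Or.inl (by simpa [h] using hg.mem v)
    · exact Or.inr ⟨σ v, by simpa using hg.mem v, h.symm⟩
  · have hne : {k | ∃ D : Finset (Fin n), IsDomSet G ↑D ∧ D.card = k}.Nonempty :=
      ⟨_, Finset.univ, fun v => Or.inl (by simp), rfl⟩
    obtain ⟨D, hD, hcard⟩ := Nat.sInf_mem hne
    have hcard' : domNum G = D.card := hcard.symm
    rw [hcard']
    have e1 : ((kDomOutput G 2).card : ℝ) = ∑ x, charge σ x := by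
      rw [← Finset.sum_fiberwise_of_maps_to (s := Finset.univ) (t := kDomOutput G 2) (g := σ)
        (fun x _ => hg.mem x)]
      rw [Finset.sum_congr rfl (g := fun _ => (1 : ℝ))]
      · simp
      · intro s hs
        apply charge_class
        rcases hg.why s hs with ⟨w, -, -, hw, -⟩ | ⟨x, hx, -⟩
        · exact ⟨w, hw⟩
        · exact ⟨x, hx⟩
    have e2 : ∑ x, charge σ x ≤ ∑ o ∈ D, ∑ x ∈ insert o (nbrs G o), charge σ x := by
      have e4 : ∀ o ∈ D, ∑ x ∈ insert o (nbrs G o), charge σ x =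
          ∑ x, if x ∈ insert o (nbrs G o) then charge σ x else 0 := by
        intro o _
        rw [← Finset.sum_filter]
        congr 1
        ext x
        simp
      rw [Finset.sum_congr rfl e4, Finset.sum_comm]
      apply Finset.sum_le_sum
      intro x _
      obtain ⟨o, ho, hx⟩ : ∃ o ∈ D, x ∈ insert o (nbrs G o) := by
        rcases hD x with h | ⟨u, hu, hux⟩
        · exact ⟨x, by simpa using h, by simp⟩
        · exact ⟨u, by simpa using hu, by simp [nbrs, hux]⟩
      have h5 := Finset.single_le_sum
        (f := fun o => if x ∈ insert o (nbrs G o) then charge σ x else 0) (s := D)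
        (fun i _ => by
          split_ifs
          · exact charge_nonneg σ x
          · exact le_refl _) ho
      rwa [if_pos hx] at h5
    have e3 : ∑ o ∈ D, ∑ x ∈ insert o (nbrs G o), charge σ x ≤ ∑ o ∈ D, (5 / 2 : ℝ) := by
      apply Finset.sum_le_sum
      intro o _
      rw [Finset.sum_insert (by simp [nbrs])]
      exact local_bound hG hpc hg o
    rw [Finset.sum_const, nsmul_eq_mul] at e3
    linarith
end

section
/- Let G be a cactus graph, let S be a set of vertices of G inducing a connected subgraph, and let v be a vertex of G not in S. Then v has at most two neighbors in S. -/
open SimpleGraph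

theorem exists_cycle_aux {V : Type*} (G : SimpleGraph V) (S : Set V)
    (hS : (SimpleGraph.induce S G).Connected) (v : V) (hv : v ∉ S) (a b : V)
    (ha : a ∈ S) (hb : b ∈ S) (hva : G.Adj v a) (hvb : G.Adj v b) (hab : a ≠ b) :
    ∃ c : G.Walk v v, c.IsCycle ∧ s(v, a) ∈ c.edges ∧ s(v, b) ∈ c.edges ∧
      ∀ x, s(v, x) ∈ c.edges → x = a ∨ x = b := by
  classical
  obtain ⟨q, hq⟩ := (hS.preconnected ⟨a, ha⟩ ⟨b, hb⟩).exists_isPath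
  obtain ⟨p, hp, hpS⟩ : ∃ p : G.Walk a b, p.IsPath ∧ v ∉ p.support := by
    refine ⟨q.map (Embedding.induce S).toHom,
      Walk.IsPath.map (f := (Embedding.induce (G := G) S).toHom) Subtype.val_injective hq, ?_⟩
    intro h
    have h' := (Walk.support_map (Embedding.induce (G := G) S).toHom q) ▸ h
    obtain ⟨y, _, hy⟩ := List.mem_map.1 h'
    exact hv (hy ▸ y.2)
  have hpe : ∀ x, s(v, x) ∉ p.edges := fun x h => hpS (p.fst_mem_support_of_mem_edges h)
  refine ⟨Walk.cons hva (p.concat hvb.symm), ?_, ?_, ?_, ?_⟩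
  · rw [Walk.cons_isCycle_iff]
    refine ⟨hp.concat hpS _, ?_⟩
    have := hpe a
    have h1 := hva.ne
    simp [Walk.edges_concat, this, hab, h1.symm]
  · simp
  · simp [Walk.edges_concat, Sym2.eq_swap]
  · intro x hx
    have := hpe x
    have h1 := hvb.ne
    have h2 := hva.ne
    simp [Walk.edges_concat, this] at hx
    grind

/-- In a finite cactus graph, if a set `S` of vertices induces a
connected subgraph, then any vertex `v ∉ S` has at most two neighbors in `S`. -/
theorem cactus_connected_set_at_most_two_neighbors {V : Type*} [Fintype V]
    (G : SimpleGraph V) (hG : IsCactus G) (S : Set V)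
    (hS : (SimpleGraph.induce S G).Connected) (v : V) (hv : v ∉ S) :
    Set.ncard {u | u ∈ S ∧ G.Adj v u} ≤ 2 := by
  by_contra hlt
  rw [not_le, Set.two_lt_ncard_iff (Set.toFinite _)] at hlt
  obtain ⟨a, b, c, ⟨ha, hva⟩, ⟨hb, hvb⟩, ⟨hc, hvc⟩, hab, hac, hbc⟩ := hlt
  obtain ⟨c₁, h1, h1a, -, h1x⟩ := exists_cycle_aux G S hS v hv a b ha hb hva hvb hab
  obtain ⟨c₂, h2, h2a, h2c, -⟩ := exists_cycle_aux G S hS v hv a c ha hc hva hvc hac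
  have h := hG.2 c₁ c₂ h1 h2 _ h1a h2a
  have h3 : s(v, c) ∈ c₁.edges := by
    have : s(v, c) ∈ {e' | e' ∈ c₂.edges} := h2c
    rw [← h] at this
    exact this
  rcases h1x c h3 with h | h
  · exact hac h.symm
  · exact hbc h.symm
end

section
/- Let Δ ≥ 4 be a perfect square. For every deterministic online algorithm ALG (in the stated online model) that always outputs a dominating set, there exist a connected finite simple graph G of maximum degree at most Δ and a revelation order σ of its vertices in which every prefix induces a connected subgraph, such that ALG(G,σ) ≥ (√Δ/2)·γ(G). -/
open SimpleGraph

attribute [local instance] Classical.propDecidable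

/-- Number of tree vertices: a root, `D` children, `m` grandchildren for each child. -/
def LL (m D : ℕ) : ℕ := D + 1 + D * m

/-- Tree edges, oriented from smaller to larger label. -/
def ET (m D x y : ℕ) : Prop :=
  (x = 0 ∧ 1 ≤ y ∧ y ≤ D) ∨ (D < y ∧ y < LL m D ∧ x = 1 + (y - D - 1) / m)

/-- Edges between grandchildren and hubs. -/
noncomputable def EH (m D : ℕ) (P : ℕ → Prop) (x y : ℕ) : Prop :=
  LL m D ≤ y ∧ D < x ∧ x < LL m D ∧ P ((x - D - 1) / m) ∧
    Nat.count P ((x - D - 1) / m) / m = y - LL m D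

/-- All the edges. -/
noncomputable def EE (m D : ℕ) (P : ℕ → Prop) (x y : ℕ) : Prop := ET m D x y ∨ EH m D P x y

theorem ET_lt {m D x y : ℕ} (h : ET m D x y) : x < y := by
  unfold ET at h
  rcases h with h | ⟨h1, h2, h3⟩
  · omega
  · have : (y - D - 1) / m < D := by
      apply Nat.div_lt_of_lt_mul
      unfold LL at h2
      rw [Nat.mul_comm]; omega
    omega

theorem EE_lt {m D x y : ℕ} {P : ℕ → Prop} (h : EE m D P x y) : x < y := by
  rcases h with h | h
  · exact ET_lt h
  · unfold EH at h; omega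

/-- The adversarial graph. -/
noncomputable def GG (m D : ℕ) (P : ℕ → Prop) (h : ℕ) : SimpleGraph (Fin (LL m D + h)) where
  Adj x y := EE m D P x y ∨ EE m D P y x
  symm := ⟨fun _ _ h => h.symm⟩
  loopless := ⟨fun x h => by rcases h with h | h <;> exact absurd (EE_lt h) (lt_irrefl _)⟩

/-- Closed neighbourhoods of the root and its children. -/
def NT (m D j : ℕ) : Set ℕ := {x | j = x ∨ ET m D j x ∨ ET m D x j}

theorem history_GG (m D : ℕ) (P : ℕ → Prop) (h : ℕ) (i : Fin (LL m D + h)) (hi : (i : ℕ) ≤ D) :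
    history (GG m D P h) i = (List.range ((i : ℕ) + 1)).map (NT m D) := by
  unfold history
  apply List.map_congr_left
  intro j hj
  have hj : j ≤ D := by have := List.mem_range.1 hj; omega
  have hL : D < LL m D := by unfold LL; omega
  ext x
  simp only [Set.mem_setOf_eq, NT]
  constructor
  · rintro ⟨v, w, rfl, rfl, hvw | hvw⟩
    · left; rw [hvw]
    · right
      rcases hvw with (h1 | h1) | (h1 | h1)
      · exact Or.inl h1
      · unfold EH at h1; omega
      · exact Or.inr h1
      · unfold EH at h1; omega
  · intro hx
    have hxL : x < LL m D := by
      rcases hx with h1 | h1 | h1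
      · omega
      · unfold ET at h1; omega
      · have := ET_lt h1; omega
    refine ⟨⟨j, by omega⟩, ⟨x, by omega⟩, rfl, rfl, ?_⟩
    rcases hx with h1 | h1 | h1
    · left; ext; exact h1
    · right; exact Or.inl (Or.inl h1)
    · right; exact Or.inr (Or.inl h1)

theorem prefix_of_lower {n : ℕ} (G : SimpleGraph (Fin n))
    (hG : ∀ i : Fin n, 0 < (i : ℕ) → ∃ j : Fin n, j < i ∧ G.Adj j i) : PrefixConnected G := by
  intro i
  have hn : 0 < n := i.pos
  let z : {v : Fin n | v ≤ i} := ⟨⟨0, hn⟩, Nat.zero_le (i : ℕ)⟩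
  have key : ∀ k : ℕ, ∀ v : {v : Fin n | v ≤ i}, ((v : Fin n) : ℕ) = k →
      (SimpleGraph.induce {v : Fin n | v ≤ i} G).Reachable z v := by
    intro k
    induction k using Nat.strong_induction_on with
    | _ k ih =>
      intro v hv
      rcases Nat.eq_zero_or_pos k with h0 | h0
      · have : z = v := by apply Subtype.ext; apply Fin.ext; simp [z, hv, h0]
        rw [this]
      · obtain ⟨j, hj, hadj⟩ := hG v (by omega)
        have hjle : j ≤ i := le_trans hj.le v.2
        have h1 := ih j (by rw [← hv]; exact hj) ⟨j, hjle⟩ rfl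
        refine h1.trans (SimpleGraph.Adj.reachable ?_)
        exact hadj
  haveI : Nonempty {v : Fin n | v ≤ i} := ⟨z⟩
  exact ⟨fun a b => (key _ a rfl).symm.trans (key _ b rfl)⟩

theorem connected_of_lower {n : ℕ} (hn : 0 < n) (G : SimpleGraph (Fin n))
    (hG : ∀ i : Fin n, 0 < (i : ℕ) → ∃ j : Fin n, j < i ∧ G.Adj j i) : G.Connected := by
  let z : Fin n := ⟨0, hn⟩
  have key : ∀ k : ℕ, ∀ v : Fin n, (v : ℕ) = k → G.Reachable z v := by
    intro k
    induction k using Nat.strong_induction_on with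
    | _ k ih =>
      intro v hv
      rcases Nat.eq_zero_or_pos k with h0 | h0
      · have : z = v := by apply Fin.ext; simp [z, hv, h0]
        rw [this]
      · obtain ⟨j, hj, hadj⟩ := hG v (by omega)
        exact (ih j (by rw [← hv]; exact hj) j rfl).trans hadj.reachable
  haveI : Nonempty (Fin n) := ⟨z⟩
  exact ⟨fun a b => (key _ a rfl).symm.trans (key _ b rfl)⟩

theorem exists_count (P : ℕ → Prop) (c D : ℕ) (h : c < Nat.count P D) :
    ∃ i < D, P i ∧ Nat.count P i = c := by
  induction D with
  | zero => simp at h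
  | succ D ih =>
    by_cases h1 : c < Nat.count P D
    · obtain ⟨i, hi, h2⟩ := ih h1
      exact ⟨i, by omega, h2⟩
    · rw [Nat.count_succ] at h
      by_cases hp : P D
      · simp only [hp, if_true] at h
        exact ⟨D, by omega, hp, by omega⟩
      · simp only [hp, if_false] at h
        omega

/-- The number of hubs. -/
noncomputable def HH (m D : ℕ) (P : ℕ → Prop) : ℕ := (Nat.count P D + m - 1) / m

theorem par_lt {m D x : ℕ} (h1 : D < x) (h2 : x < LL m D) : (x - D - 1) / m < D := by
  apply Nat.div_lt_of_lt_mul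
  unfold LL at h2
  rw [Nat.mul_comm]; omega

theorem w_lt {m D i j : ℕ} (hi : i < D) (hj : j < m) : D + 1 + i * m + j < LL m D := by
  unfold LL
  have : (i + 1) * m ≤ D * m := Nat.mul_le_mul_right _ hi
  rw [Nat.add_mul] at this
  omega

theorem w_par {m D i j : ℕ} (hj : j < m) : (D + 1 + i * m + j - D - 1) / m = i := by
  have : D + 1 + i * m + j - D - 1 = j + m * i := by rw [Nat.mul_comm]; omega
  rw [this, Nat.add_mul_div_left _ _ (by omega), Nat.div_eq_of_lt hj]; omega

theorem lower_GG (m D : ℕ) (hm : 2 ≤ m) (P : ℕ → Prop) (i : Fin (LL m D + HH m D P))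
    (hi : 0 < (i : ℕ)) : ∃ j, j < i ∧ (GG m D P (HH m D P)).Adj j i := by
  have hL : D < LL m D := by unfold LL; omega
  suffices h : ∃ j : ℕ, EE m D P j i by
    obtain ⟨j, hj⟩ := h
    have := EE_lt hj
    exact ⟨⟨j, by omega⟩, this, Or.inl hj⟩
  rcases Nat.lt_or_ge D i with h1 | h1
  · rcases Nat.lt_or_ge i (LL m D) with h2 | h2
    · exact ⟨_, Or.inl (Or.inr ⟨h1, h2, rfl⟩)⟩
    · have hk : (i : ℕ) - LL m D < HH m D P := by omega
      have hk2 : m * ((i : ℕ) - LL m D) < Nat.count P D := by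
        unfold HH at hk
        generalize (i : ℕ) - LL m D = k at *
        have h3 : (k + 1) * m ≤ Nat.count P D + m - 1 :=
          (Nat.le_div_iff_mul_le (by omega)).1 hk
        rw [Nat.add_mul, Nat.mul_comm] at h3
        omega
      obtain ⟨q, hq, hPq, hc⟩ := exists_count P _ D hk2
      have hw := w_par (m := m) (D := D) (i := q) (j := 0) (by omega)
      refine ⟨D + 1 + q * m + 0, Or.inr ⟨h2, by omega, w_lt hq (by omega), ?_, ?_⟩⟩
      · rw [hw]; exact hPq
      · rw [hw, hc, Nat.mul_div_cancel_left _ (by omega)]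
  · exact ⟨0, Or.inl (Or.inl ⟨rfl, hi, h1⟩)⟩

theorem deg_GG (m : ℕ) (hm : 2 ≤ m) (P : ℕ → Prop) (h : ℕ)
    (v : Fin (LL m (m ^ 2) + h)) : deg (GG m (m ^ 2) P h) v ≤ m ^ 2 := by
  have hsq : 2 * m ≤ m ^ 2 := by nlinarith
  have hsq' : m ^ 2 = m * m := sq m
  generalize m ^ 2 = D at *
  have hL : D < LL m D := by unfold LL; omega
  have hnb : ∀ w ∈ nbrs (GG m D P h) v, EE m D P v w ∨ EE m D P w v := by
    intro w hw
    have := (Finset.mem_filter.1 hw).2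
    exact this
  have aux : ∀ T : Finset ℕ, T.card ≤ D → (∀ w ∈ nbrs (GG m D P h) v, (w : ℕ) ∈ T) →
      deg (GG m D P h) v ≤ D := by
    intro T hT hw
    refine le_trans ?_ hT
    exact Finset.card_le_card_of_injOn (fun w => (w : ℕ)) hw (fun a _ b _ hab => Fin.ext hab)
  rcases Nat.eq_zero_or_pos (v : ℕ) with h0 | h0
  · apply aux (Finset.Icc 1 D) (by simp)
    intro w hw
    rw [Finset.mem_Icc]
    rcases hnb w hw with (h1 | h1) | h1
    · rcases h1 with h1 | ⟨_, _, h1⟩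
      · exact h1.2
      · rw [h0] at h1
        generalize ((w : ℕ) - D - 1) / m = q at h1
        omega
    · unfold EH at h1; omega
    · have := EE_lt h1; omega
  rcases Nat.lt_or_ge D v with h1 | h1
  · rcases Nat.lt_or_ge v (LL m D) with h2 | h2
    · apply aux {1 + ((v : ℕ) - D - 1) / m,
        LL m D + Nat.count P (((v : ℕ) - D - 1) / m) / m} (le_trans Finset.card_le_two (by omega))
      intro w hw
      rw [Finset.mem_insert, Finset.mem_singleton]
      rcases hnb w hw with (h3 | h3) | (h3 | h3)
      · exfalso
        rcases h3 with h3 | ⟨h3, h4, h5⟩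
        · omega
        · have := par_lt h3 h4; omega
      · right
        obtain ⟨h3, -, -, -, h4⟩ := h3
        omega
      · left
        rcases h3 with h3 | h3
        · omega
        · exact h3.2.2
      · exfalso; unfold EH at h3; omega
    · have hw : ∀ w ∈ nbrs (GG m D P h) v, EH m D P w v := by
        intro w hw
        rcases hnb w hw with (h3 | h3) | (h3 | h3)
        · have h4 := ET_lt h3
          rcases h3 with h3 | h3
          · omega
          · have := h3.2.1; omega
        · unfold EH at h3; omega
        · rcases h3 with h3 | h3
          · omega
          · have := h3.2.1; omega
        · exact h3
      have : deg (GG m D P h) v ≤ (Finset.range m ×ˢ Finset.range m).card := by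
        refine Finset.card_le_card_of_injOn
          (fun w => (Nat.count P (((w : ℕ) - D - 1) / m) % m, ((w : ℕ) - D - 1) % m)) ?_ ?_
        · intro w _
          simp [Nat.mod_lt _ (show 0 < m by omega)]
        · intro a ha b hb hab
          obtain ⟨_, a2, a3, a4, a5⟩ := hw a ha
          obtain ⟨_, b2, b3, b4, b5⟩ := hw b hb
          simp only [Prod.mk.injEq] at hab
          have e1 := Nat.count_injective a4 b4 (by
            rw [← Nat.div_add_mod (Nat.count P (((a : ℕ) - D - 1) / m)) m, hab.1, a5, ← b5,
              Nat.div_add_mod])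
          have e2 : (a : ℕ) - D - 1 = (b : ℕ) - D - 1 := by
            rw [← Nat.div_add_mod ((a : ℕ) - D - 1) m, hab.2, e1, Nat.div_add_mod]
          apply Fin.ext
          omega
      simpa [hsq'] using this
  · apply aux (insert 0 ((Finset.range m).image fun j => D + 1 + ((v : ℕ) - 1) * m + j))
    · refine le_trans (Finset.card_insert_le _ _) ?_
      have : _ ≤ (Finset.range m).card :=
        Finset.card_image_le (s := Finset.range m) (f := fun j => D + 1 + ((v : ℕ) - 1) * m + j)
      rw [Finset.card_range] at this
      omega
    · intro w hw
      rw [Finset.mem_insert, Finset.mem_image]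
      rcases hnb w hw with (h3 | h3) | (h3 | h3)
      · right
        rcases h3 with h3 | ⟨h3, h4, h5⟩
        · omega
        · refine ⟨((w : ℕ) - D - 1) % m, Finset.mem_range.2 (Nat.mod_lt _ (by omega)), ?_⟩
          have h6 : (v : ℕ) - 1 = ((w : ℕ) - D - 1) / m := by omega
          have h7 := Nat.div_add_mod ((w : ℕ) - D - 1) m
          rw [h6, Nat.mul_comm]
          omega
      · unfold EH at h3; omega
      · left; unfold ET at h3; omega
      · unfold EH at h3; omega

theorem dom_GG (m D : ℕ) (hm : 2 ≤ m) (P : ℕ → Prop) :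
    domNum (GG m D P (HH m D P)) ≤
      1 + ((Finset.range D).filter fun i => ¬ P i).card + HH m D P := by
  have hL : D < LL m D := by unfold LL; omega
  let T : Finset ℕ := {0} ∪ ((Finset.range D).filter fun i => ¬ P i).image (· + 1) ∪
    (Finset.range (HH m D P)).image (LL m D + ·)
  have hT : T.card ≤ 1 + ((Finset.range D).filter fun i => ¬ P i).card + HH m D P := by
    refine le_trans (Finset.card_union_le _ _) (add_le_add (le_trans (Finset.card_union_le _ _)
      (add_le_add (by simp) Finset.card_image_le)) (le_trans Finset.card_image_le (by simp)))
  let S : Finset (Fin (LL m D + HH m D P)) := Finset.univ.filter fun v => (v : ℕ) ∈ T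
  have hS : S.card ≤ T.card :=
    Finset.card_le_card_of_injOn (fun w => (w : ℕ)) (fun w hw => (Finset.mem_filter.1 hw).2)
      (fun a _ b _ hab => Fin.ext hab)
  refine le_trans (Nat.sInf_le ⟨S, ?_, rfl⟩) (hS.trans hT)
  have mS : ∀ v, v ∈ (↑S : Set (Fin (LL m D + HH m D P))) ↔ (v : ℕ) ∈ T := by
    intro v; simp [S]
  have mT : ∀ x, x ∈ T ↔ x = 0 ∨ (∃ i, i < D ∧ ¬ P i ∧ i + 1 = x) ∨
      (∃ k, k < HH m D P ∧ LL m D + k = x) := by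
    intro x; simp [T, and_assoc]
  intro v
  by_cases hv : (v : ℕ) ∈ T
  · left; exact (mS v).2 hv
  right
  suffices hs : ∃ j ∈ T, j < LL m D + HH m D P ∧ (EE m D P j v ∨ EE m D P v j) by
    obtain ⟨j, hj, hj2, hj3⟩ := hs
    exact ⟨⟨j, hj2⟩, (mS _).2 hj, hj3⟩
  have hv' := hv
  rw [mT] at hv
  rcases Nat.lt_or_ge D v with h1 | h1
  · rcases Nat.lt_or_ge v (LL m D) with h2 | h2
    · have hp := par_lt h1 h2
      by_cases hP : P (((v : ℕ) - D - 1) / m)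
      · have hc : Nat.count P (((v : ℕ) - D - 1) / m) / m < HH m D P := by
          have : Nat.count P (((v : ℕ) - D - 1) / m) < Nat.count P D :=
            Nat.count_strict_mono hP hp
          unfold HH
          rw [← Nat.succ_le_iff, Nat.le_div_iff_mul_le (by omega)]
          have := Nat.div_mul_le_self (Nat.count P (((v : ℕ) - D - 1) / m)) m
          rw [Nat.succ_mul]; omega
        refine ⟨_, (mT _).2 (Or.inr (Or.inr ⟨_, hc, rfl⟩)), Nat.add_lt_add_left hc _, Or.inr (Or.inr ?_)⟩
        exact ⟨Nat.le_add_right _ _, h1, h2, hP, (Nat.add_sub_cancel_left _ _).symm⟩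
      · refine ⟨_, (mT _).2 (Or.inr (Or.inl ⟨_, hp, hP, rfl⟩)), by omega, Or.inl (Or.inl ?_)⟩
        exact Or.inr ⟨h1, h2, by omega⟩
    · exact absurd (Or.inr (Or.inr ⟨(v : ℕ) - LL m D, by omega, by omega⟩)) hv
  · refine ⟨0, (mT _).2 (Or.inl rfl), by omega, Or.inl (Or.inl (Or.inl ⟨rfl, ?_, h1⟩))⟩
    by_contra hc
    exact hv (Or.inl (by omega))

theorem alg_GG (m D : ℕ) (A : List (Set ℕ) → Bool) (hA : AlwaysDominating A)
    (P : ℕ → Prop) (hP : ∀ i, P i ↔ A ((List.range (i + 1 + 1)).map (NT m D)) = true) (h : ℕ)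
    (hc : (GG m D P h).Connected) (hpc : PrefixConnected (GG m D P h)) :
    ((Finset.range D).filter fun i => P i).card +
      ((Finset.range D).filter fun i => ¬ P i).card * m ≤ (algOutput A (GG m D P h)).card := by
  have hL : D < LL m D := by unfold LL; omega
  have hdom := hA _ _ hc hpc
  have mA : ∀ (v : Fin (LL m D + h)) (i : ℕ), i < D → (v : ℕ) = i + 1 →
      (v ∈ algOutput A (GG m D P h) ↔ P i) := by
    intro v i hi hv
    simp only [algOutput, Finset.mem_filter, Finset.mem_univ, true_and]
    rw [history_GG _ _ _ _ _ (by omega), hP, hv]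
  let S1 : Finset ℕ := ((Finset.range D).filter fun i => P i).image (· + 1)
  let S2 : Finset ℕ := (((Finset.range D).filter fun i => ¬ P i) ×ˢ Finset.range m).image
    fun q => D + 1 + q.1 * m + q.2
  have c1 : S1.card = ((Finset.range D).filter fun i => P i).card :=
    Finset.card_image_of_injective _ (add_left_injective 1)
  have c2 : S2.card = ((Finset.range D).filter fun i => ¬ P i).card * m := by
    rw [Finset.card_image_of_injOn, Finset.card_product, Finset.card_range]
    rintro ⟨a, b⟩ hab ⟨c, d⟩ hcd heq
    simp only [Finset.coe_product, Set.mem_prod, Finset.mem_coe, Finset.mem_range] at hab hcd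
    simp only at heq
    have e1 := w_par (D := D) (i := a) hab.2
    have e2 := w_par (D := D) (i := c) hcd.2
    rw [heq, e2] at e1
    subst e1
    simp only [Prod.mk.injEq, true_and]
    omega
  have hdisj : Disjoint S1 S2 := by
    rw [Finset.disjoint_left]
    intro x hx hx2
    simp only [S1, S2, Finset.mem_image, Finset.mem_filter, Finset.mem_range,
      Finset.mem_product] at hx hx2
    obtain ⟨i, hi, rfl⟩ := hx
    obtain ⟨q, hq, h3⟩ := hx2
    omega
  rw [← c1, ← c2, ← Finset.card_union_of_disjoint hdisj]
  rw [← Finset.card_image_of_injective (algOutput A (GG m D P h)) Fin.val_injective]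
  apply Finset.card_le_card
  intro x hx
  rw [Finset.mem_image]
  rcases Finset.mem_union.1 hx with hx | hx
  · simp only [S1, Finset.mem_image, Finset.mem_filter, Finset.mem_range] at hx
    obtain ⟨i, ⟨hi, hPi⟩, rfl⟩ := hx
    exact ⟨⟨i + 1, by omega⟩, (mA _ i hi rfl).2 hPi, rfl⟩
  · simp only [S2, Finset.mem_image, Finset.mem_filter, Finset.mem_range,
      Finset.mem_product] at hx
    obtain ⟨⟨i, j⟩, ⟨⟨hi, hPi⟩, hj⟩, rfl⟩ := hx
    simp only at hi hPi hj ⊢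
    have hw := w_lt hi hj
    have hpar := w_par (D := D) (i := i) hj
    refine ⟨⟨D + 1 + i * m + j, by omega⟩, ?_, rfl⟩
    rcases hdom ⟨D + 1 + i * m + j, by omega⟩ with h1 | ⟨u, hu, h1⟩
    · exact h1
    · exfalso
      rcases h1 with (h1 | h1) | (h1 | h1)
      · rcases h1 with h1 | ⟨_, _, h1⟩
        · simp only at h1; omega
        · simp only [hpar] at h1
          exact hPi ((mA u i hi (by omega)).1 hu)
      · obtain ⟨h1, _⟩ := h1
        simp only at h1; omega
      · rcases h1 with h1 | ⟨h2, h3, h1⟩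
        · simp only at h1; omega
        · have := par_lt h2 h3
          simp only at h1; omega
      · obtain ⟨_, _, _, h1, _⟩ := h1
        simp only [hpar] at h1
        exact hPi h1

/-- Lower bound `√Δ/2` for any deterministic online algorithm on graphs
of maximum degree at most `Δ`, for `Δ ≥ 4` a perfect square. -/
theorem bounded_degree_lower_bound (Δ : ℕ) (hΔ : 4 ≤ Δ) (hsq : ∃ m : ℕ, Δ = m ^ 2)
    (A : List (Set ℕ) → Bool) (hA : AlwaysDominating A) :
    ∃ (n : ℕ) (G : SimpleGraph (Fin n)), G.Connected ∧ PrefixConnected G ∧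
      (∀ v, deg G v ≤ Δ) ∧
      (Real.sqrt Δ / 2) * (domNum G : ℝ) ≤ ((algOutput A G).card : ℝ) := by
  obtain ⟨m, rfl⟩ := hsq
  have hm : 2 ≤ m := by nlinarith
  obtain ⟨P, hP⟩ : ∃ P : ℕ → Prop,
      ∀ i, P i ↔ A ((List.range (i + 1 + 1)).map (NT m (m ^ 2))) = true := ⟨_, fun _ => Iff.rfl⟩
  have hlow := lower_GG m (m ^ 2) hm P
  have hconn := connected_of_lower (by unfold LL; omega) _ hlow
  have hpc := prefix_of_lower _ hlow
  refine ⟨_, GG m (m ^ 2) P (HH m (m ^ 2) P), hconn, hpc, deg_GG m hm P _, ?_⟩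
  have h1 := alg_GG m (m ^ 2) A hA P hP _ hconn hpc
  have h2 := dom_GG m (m ^ 2) hm P
  have h3 := Finset.card_filter_add_card_filter_not (s := Finset.range (m ^ 2)) (fun i => P i)
  have h4 : HH m (m ^ 2) P * m ≤ ((Finset.range (m ^ 2)).filter fun i => P i).card + m - 1 := by
    unfold HH
    rw [← Nat.count_eq_card_filter_range]
    exact Nat.div_mul_le_self _ _
  rw [Finset.card_range] at h3
  generalize ((Finset.range (m ^ 2)).filter fun i => P i).card = b at *
  generalize ((Finset.range (m ^ 2)).filter fun i => ¬ P i).card = a at *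
  generalize HH m (m ^ 2) P = h at *
  have key : m * domNum (GG m (m ^ 2) P h) ≤ 2 * (algOutput A (GG m (m ^ 2) P h)).card := by
    have h5 := Nat.mul_le_mul_left m h2
    have h6 : h * m + 1 ≤ b + m := by omega
    have h7 : a ≤ a * m := Nat.le_mul_of_pos_right _ (by omega)
    nlinarith
  have key' : (m : ℝ) * (domNum (GG m (m ^ 2) P h) : ℝ) ≤
      2 * ((algOutput A (GG m (m ^ 2) P h)).card : ℝ) := by exact_mod_cast key
  rw [Nat.cast_pow, Real.sqrt_sq (Nat.cast_nonneg m)]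
  linarith
end

section
/- Let t ≥ 3 be an integer. For every deterministic online algorithm ALG (in the stated online model) that always outputs a dominating set, there exist a connected K_{1,t}-free finite simple graph G and a revelation order σ of its vertices in which every prefix induces a connected subgraph, such that ALG(G,σ) ≥ (t − 1)·γ(G). -/
open SimpleGraph

attribute [local instance] Classical.propDecidable

/-- `G` contains no induced subgraph isomorphic to the star `K_{1,t}`: there is no vertex
with `t` pairwise non-adjacent neighbors. -/
def K1tFree {V : Type*} (G : SimpleGraph V) (t : ℕ) : Prop :=
  ¬ ∃ (v : V) (T : Finset V), T.card = t ∧ (∀ w ∈ T, G.Adj v w) ∧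
      ∀ w₁ ∈ T, ∀ w₂ ∈ T, w₁ ≠ w₂ → ¬ G.Adj w₁ w₂

/-- `I` is an independent set: pairwise non-adjacent vertices. -/
def IsIndepSet' {V : Type*} (G : SimpleGraph V) (I : Set V) : Prop :=
  ∀ u ∈ I, ∀ v ∈ I, u ≠ v → ¬ G.Adj u v

/-- `N[v_j] = {0, …, dd t (j+1) - 1}` for the revealed vertices. -/
def dd (t : ℕ) : ℕ → ℕ
  | 0 => 1
  | i + 1 => dd t i + (t - 1 - i)

theorem dd_mono (t : ℕ) : Monotone (dd t) :=
  monotone_nat_of_le_succ fun n => by simp [dd]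

theorem le_dd_succ (t a : ℕ) (ht : 3 ≤ t) : t ≤ dd t (a + 1) := by
  have h : dd t 1 ≤ dd t (a + 1) := dd_mono t (by omega)
  have : dd t 1 = t := by simp [dd]; omega
  omega

theorem lt_dd (t i : ℕ) (ht : 3 ≤ t) (hi : i + 2 ≤ t) : i < dd t i := by
  cases i with
  | zero => simp [dd]
  | succ a => have := le_dd_succ t a ht; omega

/-- The bound on the larger neighbours of `a` in the hard graph `i`. -/
def bb (t i a : ℕ) : ℕ := dd t (if a ≤ i then a + 1 else i)

/-- The hard graph: the first `i` vertices are accepted, vertex `i` is universal. -/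
def HG (t i : ℕ) : SimpleGraph (Fin (dd t (i + 1))) where
  Adj u v := ((u : ℕ) < v ∧ (v : ℕ) < bb t i u) ∨ ((v : ℕ) < u ∧ (u : ℕ) < bb t i v)
  symm := ⟨fun _ _ h => h.symm⟩
  loopless := ⟨fun _ h => by omega⟩

theorem HG_adj_of_lt {t i : ℕ} {u v : Fin (dd t (i + 1))} (h : (u : ℕ) < v)
    (h2 : (v : ℕ) < bb t i u) : (HG t i).Adj u v := Or.inl ⟨h, h2⟩

theorem bb_of_le {t i a : ℕ} (h : a ≤ i) : bb t i a = dd t (a + 1) := by simp [bb, h]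

theorem bb_of_lt {t i a : ℕ} (h : i < a) : bb t i a = dd t i := by
  simp [bb, Nat.not_le.mpr h]

theorem HG_univ {t i : ℕ} (ht : 3 ≤ t) (hi : i + 2 ≤ t) (u v : Fin (dd t (i + 1)))
    (hu : (u : ℕ) = i) (h : u ≠ v) : (HG t i).Adj u v := by
  have h' : (u : ℕ) ≠ v := fun e => h (Fin.ext e)
  have hv := v.isLt
  rcases lt_or_gt_of_ne h' with h1 | h1
  · exact Or.inl ⟨h1, by rw [bb_of_le (by omega), hu]; exact hv⟩
  · refine Or.inr ⟨h1, ?_⟩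
    rw [bb_of_le (by omega)]
    have := le_dd_succ t v ht
    omega

/-- Before `i`, the closed neighborhoods do not depend on `i`. -/
theorem HG_history {t i : ℕ} (ht : 3 ≤ t) (hi : i + 2 ≤ t) (j : Fin (dd t (i + 1)))
    (hj : (j : ℕ) ≤ i) :
    history (HG t i) j = (List.range ((j : ℕ) + 1)).map fun l => {m : ℕ | m < dd t (l + 1)} := by
  unfold history
  apply List.map_congr_left
  intro l hl
  rw [List.mem_range] at hl
  ext m
  simp only [Set.mem_setOf_eq]
  have hl1 := le_dd_succ t l ht
  have hmono : dd t (l + 1) ≤ dd t (i + 1) := dd_mono t (by omega)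
  constructor
  · rintro ⟨v, w, rfl, rfl, h | h⟩
    · subst h; omega
    · rcases h with ⟨_, h⟩ | ⟨h, _⟩
      · rwa [bb_of_le (by omega)] at h
      · omega
  · intro hm
    refine ⟨⟨l, by omega⟩, ⟨m, by omega⟩, rfl, rfl, ?_⟩
    rcases lt_trichotomy l m with h | h | h
    · exact Or.inr (Or.inl ⟨h, by rw [bb_of_le (by simp; omega)]; exact hm⟩)
    · exact Or.inl (Fin.ext h)
    · refine Or.inr (Or.inr ⟨h, ?_⟩)
      have := le_dd_succ t m ht
      rw [bb_of_le (by simp; omega)]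
      simp only
      omega

theorem connected_of_univ {V : Type*} (G : SimpleGraph V) (c : V)
    (h : ∀ v, c ≠ v → G.Adj c v) : G.Connected := by
  have hr : ∀ v, G.Reachable c v := fun v => by
    by_cases e : c = v
    · subst e; exact Reachable.refl _
    · exact (h v e).reachable
  haveI : Nonempty V := ⟨c⟩
  exact ⟨fun u v => (hr u).symm.trans (hr v)⟩

theorem HG_prefix {t i : ℕ} (ht : 3 ≤ t) (hi : i + 2 ≤ t) : PrefixConnected (HG t i) := by
  intro k
  have h1 := le_dd_succ t i ht
  by_cases hk : (k : ℕ) < i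
  · refine connected_of_univ _ ⟨⟨0, by omega⟩, show (0 : ℕ) ≤ k from Nat.zero_le _⟩ ?_
    rintro ⟨v, hv⟩ hne
    have hv' : (v : ℕ) ≤ k := hv
    have hne' : (0 : ℕ) ≠ v := fun e => hne (Subtype.ext (Fin.ext e))
    refine HG_adj_of_lt (by simp; omega) ?_
    have := le_dd_succ t 0 ht
    rw [bb_of_le (by simp)]
    show (v : ℕ) < dd t (0 + 1)
    omega
  · refine connected_of_univ _ ⟨⟨i, by omega⟩, show i ≤ (k : ℕ) by omega⟩ ?_
    rintro ⟨v, hv⟩ hne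
    exact HG_univ ht hi _ _ rfl fun e => hne (Subtype.ext e)

theorem HG_connected {t i : ℕ} (ht : 3 ≤ t) (hi : i + 2 ≤ t) : (HG t i).Connected := by
  have h1 := le_dd_succ t i ht
  exact connected_of_univ _ ⟨i, by omega⟩ fun v h => HG_univ ht hi _ _ rfl h

theorem HG_domNum {t i : ℕ} (ht : 3 ≤ t) (hi : i + 2 ≤ t) : domNum (HG t i) ≤ 1 := by
  have h1 := le_dd_succ t i ht
  apply Nat.sInf_le
  refine ⟨{⟨i, by omega⟩}, fun v => ?_, by simp⟩
  by_cases h : (⟨i, by omega⟩ : Fin (dd t (i + 1))) = v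
  · left; simp [h]
  · right; exact ⟨_, by simp, HG_univ ht hi _ _ rfl h⟩

/-- Colour classes are cliques. -/
def col (t i x : ℕ) : ℕ :=
  if dd t i ≤ x then x - dd t i + i else if i < x ∧ 2 ≤ i then 1 else 0

theorem HG_col {t i : ℕ} (ht : 3 ≤ t) (hi : i + 2 ≤ t) (u v : Fin (dd t (i + 1)))
    (h : (u : ℕ) < v) (hc : col t i u = col t i v) : (HG t i).Adj u v := by
  have hlt := lt_dd t i ht hi
  by_cases hu : (u : ℕ) = i
  · exact HG_univ ht hi u v hu fun e => by subst e; omega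
  by_cases hv : (v : ℕ) = i
  · exact (HG_univ ht hi v u hv fun e => by subst e; omega).symm
  have hvd : (v : ℕ) < dd t i := by
    by_contra hcon
    unfold col at hc
    have h0 : i = 0 → dd t i = 1 := by rintro rfl; rfl
    split_ifs at hc <;> omega
  refine HG_adj_of_lt h ?_
  by_cases hui : (u : ℕ) < i
  · rw [bb_of_le hui.le]
    have := le_dd_succ t u ht
    by_cases hvi : (v : ℕ) < i
    · omega
    · have : i < 2 := by
        by_contra hcon
        unfold col at hc
        split_ifs at hc <;> omega
      have h1 : i = 1 := by omega
      subst h1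
      have : (u : ℕ) = 0 := by omega
      rw [this]; exact hvd
  · rw [bb_of_lt (by omega)]; exact hvd

theorem HG_free {t i : ℕ} (ht : 3 ≤ t) (hi : i + 2 ≤ t) : K1tFree (HG t i) t := by
  rintro ⟨_, T, hT, _, hind⟩
  have hlt := lt_dd t i ht hi
  obtain ⟨x, hx, y, hy, hne, hxy⟩ := Finset.exists_ne_map_eq_of_card_lt_of_maps_to
    (s := T) (t := Finset.range (t - 1)) (f := fun x => col t i x)
    (by rw [hT, Finset.card_range]; omega)
    (by
      intro x _
      have hx := x.isLt
      have hd : dd t (i + 1) = dd t i + (t - 1 - i) := rfl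
      simp only [Finset.coe_range, Set.mem_Iio]
      unfold col
      split_ifs <;> omega)
  have hne' : (x : ℕ) ≠ y := fun e => hne (Fin.ext e)
  rcases lt_or_gt_of_ne hne' with h | h
  · exact hind x hx y hy hne (HG_col ht hi x y h hxy)
  · exact hind y hy x hx hne.symm (HG_col ht hi y x h hxy.symm)

/-- The decision of `A` at vertex `j` of any hard graph `i ≥ j`. -/
def dec (t : ℕ) (A : List (Set ℕ) → Bool) (j : ℕ) : Bool :=
  A ((List.range (j + 1)).map fun l => {m : ℕ | m < dd t (l + 1)})

theorem HG_mem {t i : ℕ} (ht : 3 ≤ t) (hi : i + 2 ≤ t) (A : List (Set ℕ) → Bool)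
    (j : Fin (dd t (i + 1))) (hj : (j : ℕ) ≤ i) :
    j ∈ algOutput A (HG t i) ↔ dec t A j = true := by
  simp [algOutput, HG_history ht hi j hj, dec]

theorem HG_pendant {t i : ℕ} (ht : 3 ≤ t) (hi : i + 2 ≤ t) (u v : Fin (dd t (i + 1)))
    (hv : dd t i ≤ v) (h : (HG t i).Adj u v) : (u : ℕ) = i := by
  have hlt := lt_dd t i ht hi
  rcases h with ⟨_, h2⟩ | ⟨h1, h2⟩
  · by_cases hu : (u : ℕ) ≤ i
    · rw [bb_of_le hu] at h2
      by_contra hne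
      have : dd t (u + 1) ≤ dd t i := dd_mono t (by omega)
      omega
    · rw [bb_of_lt (by omega)] at h2; omega
  · rw [bb_of_lt (by omega)] at h2; omega

theorem HG_final {t i : ℕ} (ht : 3 ≤ t) (hi : i + 2 ≤ t) (A : List (Set ℕ) → Bool)
    (f : Fin (t - 1) → Fin (dd t (i + 1))) (hf : Function.Injective f)
    (h : ∀ k, f k ∈ algOutput A (HG t i)) :
    ∃ (n : ℕ) (G : SimpleGraph (Fin n)), G.Connected ∧ PrefixConnected G ∧
      K1tFree G t ∧ (t - 1) * domNum G ≤ (algOutput A G).card := by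
  refine ⟨_, HG t i, HG_connected ht hi, HG_prefix ht hi, HG_free ht hi, ?_⟩
  have h1 : (Finset.univ.image f).card = t - 1 := by
    rw [Finset.card_image_of_injective _ hf]; simp
  have h2 : Finset.univ.image f ⊆ algOutput A (HG t i) := by
    intro x hx
    obtain ⟨k, _, rfl⟩ := Finset.mem_image.mp hx
    exact h k
  calc (t - 1) * domNum (HG t i) ≤ (t - 1) * 1 := Nat.mul_le_mul_left _ (HG_domNum ht hi)
    _ = (Finset.univ.image f).card := by rw [h1, mul_one]
    _ ≤ _ := Finset.card_le_card h2

/-- Lower bound `t - 1` for any deterministic online algorithm on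
`K_{1,t}`-free graphs. -/
theorem k1t_free_lower_bound (t : ℕ) (ht : 3 ≤ t)
    (A : List (Set ℕ) → Bool) (hA : AlwaysDominating A) :
    ∃ (n : ℕ) (G : SimpleGraph (Fin n)), G.Connected ∧ PrefixConnected G ∧
      K1tFree G t ∧ (t - 1) * domNum G ≤ (algOutput A G).card := by
  by_cases hall : ∃ i, i + 2 ≤ t ∧ dec t A i = false
  · -- the first refused vertex
    have hi := (Nat.find_spec hall).1
    have hfalse := (Nat.find_spec hall).2
    have hmin : ∀ j < Nat.find hall, dec t A j = true := by
      intro j hj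
      have := Nat.find_min hall hj
      by_contra hcon
      exact this ⟨by omega, by simpa using hcon⟩
    generalize Nat.find hall = i at hi hfalse hmin
    have hlt := lt_dd t i ht hi
    have hd : dd t (i + 1) = dd t i + (t - 1 - i) := rfl
    have hdom := hA _ (HG t i) (HG_connected ht hi) (HG_prefix ht hi)
    refine HG_final ht hi A
      (fun k => ⟨if (k : ℕ) < i then k else dd t i + (k - i), by
        have := k.isLt
        split_ifs <;> omega⟩) ?_ ?_
    · intro k l hkl
      have := congrArg Fin.val hkl
      simp only at this
      apply Fin.ext
      split_ifs at this <;> omega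
    · intro k
      by_cases hk : (k : ℕ) < i
      · rw [HG_mem ht hi _ _ (by simp [hk]; omega)]
        simpa [hk] using hmin k hk
      · rcases hdom ⟨if (k : ℕ) < i then k else dd t i + (k - i), by
          have := k.isLt
          split_ifs <;> omega⟩ with h | ⟨u, hu, hadj⟩
        · exact h
        · exfalso
          have hui := HG_pendant ht hi _ _ (by simp [hk]) hadj
          have hu2 := (HG_mem ht hi A u hui.le).mp hu
          rw [hui, hfalse] at hu2
          exact Bool.false_ne_true hu2
  · push Not at hall
    have hi : (t - 2) + 2 ≤ t := by omega
    have hd := le_dd_succ t (t - 2) ht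
    refine HG_final ht hi A (fun k => ⟨k, by have := k.isLt; omega⟩) ?_ ?_
    · intro k l hkl
      have := congrArg Fin.val hkl
      exact Fin.ext this
    · intro k
      have hk := k.isLt
      rw [HG_mem ht hi _ _ (by simp only; omega)]
      simpa using hall k (by omega)
end

section
/- Let t ≥ 3 be an integer and let G be a K_{1,t}-free finite simple graph. Then for every independent set I of G and every dominating set D of G, |D| ≥ |I|/(t − 1). -/
open SimpleGraph

attribute [local instance] Classical.propDecidable

/-- In a `K_{1,t}`-free graph, every dominating set `D` and independent
set `I` satisfy `|D| ≥ |I|/(t-1)`. -/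
theorem dom_ge_indep_div (t : ℕ) (ht : 3 ≤ t) {V : Type*} [Fintype V]
    (G : SimpleGraph V) (hfree : K1tFree G t) (I D : Finset V)
    (hI : IsIndepSet' G ↑I) (hD : IsDomSet G ↑D) :
    ((I.card : ℝ)) / ((t : ℝ) - 1) ≤ (D.card : ℝ) := by
  have hcov : I ⊆ D.biUnion (fun d => I.filter (fun x => x = d ∨ G.Adj d x)) := by
    intro x hx
    rw [Finset.mem_biUnion]
    rcases hD x with h | ⟨u, hu, hux⟩
    · exact ⟨x, by simpa using h, Finset.mem_filter.2 ⟨hx, Or.inl rfl⟩⟩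
    · exact ⟨u, by simpa using hu, Finset.mem_filter.2 ⟨hx, Or.inr hux⟩⟩
  have hb : ∀ d ∈ D, (I.filter (fun x => x = d ∨ G.Adj d x)).card ≤ t - 1 := by
    intro d _
    by_cases hd : d ∈ I
    · have hs : I.filter (fun x => x = d ∨ G.Adj d x) ⊆ {d} := by
        intro x hx
        obtain ⟨hxI, hx⟩ := Finset.mem_filter.1 hx
        rw [Finset.mem_singleton]
        by_contra hne
        rcases hx with h | h
        · exact hne h
        · exact hI d (by simpa using hd) x (by simpa using hxI) (Ne.symm hne) h
      have := Finset.card_le_card hs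
      rw [Finset.card_singleton] at this
      omega
    · by_contra hlt
      have hge : t ≤ (I.filter (fun x => x = d ∨ G.Adj d x)).card := by omega
      obtain ⟨T, hT, hc⟩ := Finset.exists_subset_card_eq hge
      refine hfree ⟨d, T, hc, ?_, ?_⟩
      · intro w hw
        obtain ⟨hwI, h | h⟩ := Finset.mem_filter.1 (hT hw)
        · exact absurd (h ▸ hwI) hd
        · exact h
      · intro a ha b hb hab
        have h1 := (Finset.mem_filter.1 (hT ha)).1
        have h2 := (Finset.mem_filter.1 (hT hb)).1
        exact hI a (by simpa using h1) b (by simpa using h2) hab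
  have hmain : I.card ≤ D.card * (t - 1) :=
    (Finset.card_le_card hcov).trans (Finset.card_biUnion_le_card_mul _ _ _ hb)
  have ht' : (3 : ℝ) ≤ t := by exact_mod_cast ht
  rw [div_le_iff₀ (by linarith)]
  have h2 : (I.card : ℝ) ≤ ((D.card * (t - 1) : ℕ) : ℝ) := by exact_mod_cast hmain
  rw [Nat.cast_mul, Nat.cast_sub (by omega), Nat.cast_one] at h2
  exact h2
end

section
/- Let t ≥ 3 be an integer. For every connected K_{1,t}-free finite simple graph G and every revelation order v_1,…,v_n of its vertices in which every prefix induces a connected subgraph, the set S of vertices selected by the algorithm GREEDY is an independent dominating set of G and satisfies |S| ≤ (t − 1)·γ(G). -/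
open SimpleGraph

attribute [local instance] Classical.propDecidable

/-- GREEDY's decision: select `vi` iff it is not yet dominated. -/
def greedyDecision {n : ℕ} (G : SimpleGraph (Fin n)) (vi : Fin n)
    (Sprev : Finset (Fin n)) : Prop :=
  vi ∈ Uset G (vi : ℕ) Sprev

/-- The set of vertices selected by GREEDY after the first `i` decisions. -/
noncomputable def greedyStep {n : ℕ} (G : SimpleGraph (Fin n)) : ℕ → Finset (Fin n)
  | 0 => ∅
  | i + 1 =>
    greedyStep G i ∪
      if h : i < n then
        if greedyDecision G ⟨i, h⟩ (greedyStep G i) then {⟨i, h⟩} else ∅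
      else ∅

/-- The output of the online algorithm GREEDY. -/
noncomputable def greedyOutput {n : ℕ} (G : SimpleGraph (Fin n)) : Finset (Fin n) :=
  greedyStep G n

theorem mem_closedN_iff {n : ℕ} (G : SimpleGraph (Fin n)) (A : Finset (Fin n)) (v : Fin n) :
    v ∈ closedN G A ↔ v ∈ A ∨ ∃ u ∈ A, G.Adj u v := by
  simp [closedN]

theorem greedyDecision_iff {n : ℕ} (G : SimpleGraph (Fin n)) (v : Fin n)
    (S : Finset (Fin n)) :
    greedyDecision G v S ↔ ¬ (v ∈ S ∨ ∃ u ∈ S, G.Adj u v) := by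
  unfold greedyDecision Uset
  rw [Finset.mem_sdiff, mem_closedN_iff, mem_closedN_iff]
  have : v ∈ Rset n v := by simp [Rset]
  exact and_iff_right (Or.inl this)

theorem mem_greedyStep_succ {n : ℕ} (G : SimpleGraph (Fin n)) (i : ℕ) (v : Fin n) :
    v ∈ greedyStep G (i + 1) ↔ v ∈ greedyStep G i ∨
      ((v : ℕ) = i ∧ ¬ (v ∈ greedyStep G i ∨ ∃ u ∈ greedyStep G i, G.Adj u v)) := by
  rw [greedyStep, Finset.mem_union]
  refine or_congr Iff.rfl ?_
  rw [← greedyDecision_iff]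
  constructor
  · intro hv
    split_ifs at hv with h1 h2
    · rw [Finset.mem_singleton] at hv
      subst hv
      exact ⟨rfl, h2⟩
    · simp at hv
    · simp at hv
  · rintro ⟨rfl, h2⟩
    simp [h2]

theorem greedyStep_mono {n : ℕ} (G : SimpleGraph (Fin n)) : Monotone (greedyStep G) := by
  refine monotone_nat_of_le_succ fun i v hv => ?_
  rw [mem_greedyStep_succ]
  exact Or.inl hv

theorem greedyStep_indep {n : ℕ} (G : SimpleGraph (Fin n)) (i : ℕ) :
    ∀ u ∈ greedyStep G i, ∀ v ∈ greedyStep G i, u ≠ v → ¬ G.Adj u v := by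
  induction i with
  | zero => simp [greedyStep]
  | succ i ih =>
    intro u hu v hv huv hadj
    rw [mem_greedyStep_succ] at hu hv
    rcases hu with hu | ⟨hu, hu'⟩ <;> rcases hv with hv | ⟨hv, hv'⟩
    · exact ih u hu v hv huv hadj
    · exact hv' (Or.inr ⟨u, hu, hadj⟩)
    · exact hu' (Or.inr ⟨v, hv, hadj.symm⟩)
    · exact huv (Fin.ext (hu.trans hv.symm))

theorem greedyOutput_dom {n : ℕ} (G : SimpleGraph (Fin n)) :
    ∀ v, v ∈ greedyOutput G ∨ ∃ u ∈ greedyOutput G, G.Adj u v := by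
  intro v
  have h1 : greedyStep G v ⊆ greedyOutput G := greedyStep_mono G v.2.le
  have h2 : greedyStep G (v + 1) ⊆ greedyOutput G := greedyStep_mono G v.2
  by_cases h : v ∈ greedyStep G v ∨ ∃ u ∈ greedyStep G v, G.Adj u v
  · rcases h with h | ⟨u, hu, huv⟩
    · exact Or.inl (h1 h)
    · exact Or.inr ⟨u, h1 hu, huv⟩
  · exact Or.inl (h2 ((mem_greedyStep_succ G v v).2 (Or.inr ⟨rfl, h⟩)))

theorem indep_card_le {n t : ℕ} (ht : 3 ≤ t) (G : SimpleGraph (Fin n)) (hfree : K1tFree G t)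
    (S D : Finset (Fin n)) (hS : ∀ u ∈ S, ∀ v ∈ S, u ≠ v → ¬ G.Adj u v)
    (hD : IsDomSet G ↑D) : S.card ≤ D.card * (t - 1) := by
  have hsub : S ⊆ D.biUnion fun d => S.filter fun v => v = d ∨ G.Adj d v := by
    intro v hv
    rw [Finset.mem_biUnion]
    rcases hD v with h | ⟨u, hu, huv⟩
    · exact ⟨v, h, Finset.mem_filter.2 ⟨hv, Or.inl rfl⟩⟩
    · exact ⟨u, hu, Finset.mem_filter.2 ⟨hv, Or.inr huv⟩⟩
  refine (Finset.card_le_card hsub).trans (Finset.card_biUnion_le_card_mul _ _ _ fun d _ => ?_)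
  by_cases hd : d ∈ S
  · have : (S.filter fun v => v = d ∨ G.Adj d v) ⊆ {d} := by
      intro v hv
      rw [Finset.mem_filter] at hv
      rw [Finset.mem_singleton]
      by_contra hne
      exact hS d hd v hv.1 (Ne.symm hne) (hv.2.resolve_left hne)
    have := Finset.card_le_card this
    rw [Finset.card_singleton] at this
    omega
  · by_contra hlt
    obtain ⟨T, hT, hcard⟩ := Finset.exists_subset_card_eq
      (show t ≤ (S.filter fun v => v = d ∨ G.Adj d v).card by omega)
    have hT' : ∀ w ∈ T, w ∈ S ∧ (w = d ∨ G.Adj d w) := fun w hw => Finset.mem_filter.1 (hT hw)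
    refine hfree ⟨d, T, hcard, fun w hw => ?_, fun a ha b hb => hS a (hT' a ha).1 b (hT' b hb).1⟩
    refine (hT' w hw).2.resolve_left ?_
    rintro rfl
    exact hd (hT' w hw).1

/-- On every connected `K_{1,t}`-free graph revealed with connected
prefixes, GREEDY outputs an independent dominating set of size at most `(t-1)·γ(G)`. -/
theorem greedy_k1t_free (t : ℕ) (ht : 3 ≤ t) {n : ℕ} (G : SimpleGraph (Fin n))
    (hconn : G.Connected) (hfree : K1tFree G t) (hpc : PrefixConnected G) :
    IsDomSet G ↑(greedyOutput G) ∧ IsIndepSet' G ↑(greedyOutput G) ∧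
      (greedyOutput G).card ≤ (t - 1) * domNum G := by
  refine ⟨fun v => ?_, fun u hu v hv => ?_, ?_⟩
  · exact greedyOutput_dom G v
  · exact greedyStep_indep G n u hu v hv
  · have hne : {k | ∃ D : Finset (Fin n), IsDomSet G ↑D ∧ D.card = k}.Nonempty :=
      ⟨_, greedyOutput G, greedyOutput_dom G, rfl⟩
    obtain ⟨D, hD, hc⟩ := Nat.sInf_mem hne
    rw [mul_comm, domNum, ← hc]
    exact indep_card_le ht G hfree _ D (greedyStep_indep G n) hD
end
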